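/- arXiv:2506.09165 — 2 statements merged into one kernel-verified Lean document; each statement's English description precedes it below -/
import Mathlib

section
/- Fix q > 0 and L > 0. There exists a constant C > 0 depending only on L and q such that for all integers m ≥ 1, d ≥ 1 and every ε > 0, there exists a finite set N of integrable functions on [0,1]^d with log |N| ≤ C · m · d^{1+1/q} · (1/ε)^{1/q} such that for every f ∈ G^{(m,d)}_{F_{L,q}} there is g ∈ N with TV(f,g) ≤ ε. -/
open MeasureTheory
open scoped ENNReal

/-- The unit cube `[0,1]^d`. -/
def unitCube (d : ℕ) : Set (Fin d → ℝ) :=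
  Set.univ.pi fun _ => Set.Icc (0 : ℝ) 1

/-- For `q > 0`, the integer part `l` in the decomposition `q = l + β` with `β ∈ (0,1]`. -/
noncomputable def holderInt (q : ℝ) : ℕ := ⌈q⌉₊ - 1

/-- The class `F_{L,q}` of `q`-Hölder smooth probability densities on `[0,1]`:
nonnegative, integrating to one, `l`-times continuously differentiable on `[0,1]`, with the
`l`-th derivative `β`-Hölder continuous with constant `L`, where `q = l + β`, `β ∈ (0,1]`. -/
noncomputable def HolderClass (L q : ℝ) : Set (ℝ → ℝ) :=
  {f | (∀ x ∈ Set.Icc (0 : ℝ) 1, 0 ≤ f x) ∧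
    (∫ x in Set.Icc (0 : ℝ) 1, f x) = 1 ∧
    ContDiffOn ℝ (holderInt q) f (Set.Icc (0 : ℝ) 1) ∧
    ∀ x ∈ Set.Icc (0 : ℝ) 1, ∀ y ∈ Set.Icc (0 : ℝ) 1,
      |iteratedDerivWithin (holderInt q) f (Set.Icc (0 : ℝ) 1) x -
        iteratedDerivWithin (holderInt q) f (Set.Icc (0 : ℝ) 1) y| ≤
        L * |x - y| ^ (q - holderInt q)}

/-- The class `G^{(m,d)}_{F_{L,q}}` of `m`-component mixtures of products of densities
from `F_{L,q}`. -/
noncomputable def MixtureClass (L q : ℝ) (m d : ℕ) : Set ((Fin d → ℝ) → ℝ) :=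
  {g | ∃ (π : Fin m → ℝ) (f : Fin m → Fin d → ℝ → ℝ),
    (∀ k, 0 ≤ π k) ∧ (∑ k, π k = 1) ∧ (∀ k j, f k j ∈ HolderClass L q) ∧
    g = fun x => ∑ k, π k * ∏ j, f k j (x j)}

/-- The Hellinger distance between densities on `[0,1]^d`. -/
noncomputable def hellingerDist {d : ℕ} (p q : (Fin d → ℝ) → ℝ) : ℝ :=
  Real.sqrt (∫ x in unitCube d, (Real.sqrt (p x) - Real.sqrt (q x)) ^ 2)

/-- The total variation distance between densities on `[0,1]^d`. -/
noncomputable def tvDist {d : ℕ} (p q : (Fin d → ℝ) → ℝ) : ℝ :=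
  (1 / 2) * ∫ x in unitCube d, |p x - q x|

/-- A polynomial of degree at most `l` is bounded on `[0,1]` by its values at `l + 1` separated
nodes. -/
lemma abs_eval_le_of_abs_eval_nodes_le {l : ℕ} {h B : ℝ} (hh : 0 < h) {v : Fin (l + 1) → ℝ}
    (hv : ∀ i, v i ∈ Set.Icc (0 : ℝ) 1) (hsep : ∀ i j, i ≠ j → h ≤ |v i - v j|)
    {p : Polynomial ℝ} (hp : p.natDegree ≤ l) (hB : ∀ i, |p.eval (v i)| ≤ B)
    {x : ℝ} (hx : x ∈ Set.Icc (0 : ℝ) 1) :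
    |p.eval x| ≤ (l + 1) * (1 / h) ^ l * B := by
  have hinj : Set.InjOn v (Finset.univ : Finset (Fin (l + 1))) := by
    intro i _ j _ hij
    by_contra hne
    have := hsep i j hne
    rw [hij, sub_self, abs_zero] at this
    linarith
  have hdeg : p.degree < ((Finset.univ : Finset (Fin (l + 1))).card : WithBot ℕ) := by
    rw [Finset.card_univ, Fintype.card_fin]
    exact (Polynomial.natDegree_le_iff_degree_le.1 hp).trans_lt (by exact_mod_cast Nat.lt_succ_self l)
  have hbasis : ∀ i, |(Lagrange.basis Finset.univ v i).eval x| ≤ (1 / h) ^ l := by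
    intro i
    rw [Lagrange.basis, Polynomial.eval_prod, Finset.abs_prod]
    have hcard : (Finset.univ.erase i).card = l := by simp
    refine (Finset.prod_le_prod (g := fun _ => 1 / h) (fun _ _ => abs_nonneg _)
      fun j hj => ?_).trans_eq (by rw [Finset.prod_const, hcard])
    have hne : i ≠ j := (Finset.ne_of_mem_erase hj).symm
    have hxj : |x - v j| ≤ 1 := by
      rw [abs_le]
      constructor <;> linarith [hx.1, hx.2, (hv j).1, (hv j).2]
    simp only [Lagrange.basisDivisor, Polynomial.eval_mul, Polynomial.eval_C, Polynomial.eval_sub,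
      Polynomial.eval_X, abs_mul, abs_inv]
    rw [one_div]
    calc |v i - v j|⁻¹ * |x - v j| ≤ h⁻¹ * 1 := by
          gcongr
          exact hsep i j hne
      _ = h⁻¹ := mul_one _
  rw [Lagrange.eq_interpolate hinj hdeg, Lagrange.interpolate_apply, Polynomial.eval_finsetSum]
  refine (Finset.abs_sum_le_sum_abs _ _).trans ?_
  calc ∑ i, |(Polynomial.C (p.eval (v i)) * Lagrange.basis Finset.univ v i).eval x|
      ≤ ∑ _i : Fin (l + 1), B * (1 / h) ^ l := by
        refine Finset.sum_le_sum fun i _ => ?_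
        rw [Polynomial.eval_mul, Polynomial.eval_C, abs_mul]
        exact mul_le_mul (hB i) (hbasis i) (abs_nonneg _) ((abs_nonneg _).trans (hB i))
    _ = (l + 1) * (1 / h) ^ l * B := by
        rw [Finset.sum_const, Finset.card_univ, Fintype.card_fin, nsmul_eq_mul]
        push_cast
        ring

lemma exists_derivative_eq (p : Polynomial ℝ) :
    ∃ P : Polynomial ℝ, P.natDegree ≤ p.natDegree + 1 ∧ Polynomial.derivative P = p := by
  refine ⟨∑ i ∈ Finset.range (p.natDegree + 1),
    Polynomial.monomial (i + 1) (p.coeff i / (i + 1)), ?_, ?_⟩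
  · refine Polynomial.natDegree_sum_le_of_forall_le _ _ fun i hi => ?_
    refine (Polynomial.natDegree_monomial_le _).trans ?_
    have := Finset.mem_range.1 hi
    omega
  · rw [Polynomial.derivative_sum]
    conv_rhs => rw [p.as_sum_range]
    refine Finset.sum_congr rfl fun i _ => ?_
    rw [Polynomial.derivative_monomial]
    have : (i : ℝ) + 1 ≠ 0 := by positivity
    push_cast
    rw [div_mul_cancel₀ _ this]

/-- A function whose `l`-th derivative is `β`-Hölder is approximated on every interval by a
polynomial of degree at most `l`, with error of the order of the length to the power `β + l`. -/
lemma exists_polynomial_approx {L β : ℝ} (hL : 0 ≤ L) (hβ : 0 ≤ β) {a b : ℝ} (ha : 0 ≤ a)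
    (hab : a < b) (hb : b ≤ 1) (l : ℕ) :
    ∀ f : ℝ → ℝ, ContDiffOn ℝ l f (Set.Icc (0 : ℝ) 1) →
      (∀ x ∈ Set.Icc (0 : ℝ) 1, ∀ y ∈ Set.Icc (0 : ℝ) 1,
        |iteratedDerivWithin l f (Set.Icc (0 : ℝ) 1) x -
          iteratedDerivWithin l f (Set.Icc (0 : ℝ) 1) y| ≤ L * |x - y| ^ β) →
      ∃ p : Polynomial ℝ, p.natDegree ≤ l ∧
        ∀ x ∈ Set.Icc a b, |f x - p.eval x| ≤ L * (b - a) ^ (β + l) := by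
  have hsub : Set.Icc a b ⊆ Set.Icc (0 : ℝ) 1 := Set.Icc_subset_Icc ha hb
  have ha' : a ∈ Set.Icc a b := Set.left_mem_Icc.2 hab.le
  have hlen : 0 < b - a := sub_pos.2 hab
  have hdist : ∀ x ∈ Set.Icc a b, |x - a| ≤ b - a := fun x hx => by
    rw [abs_of_nonneg (sub_nonneg.2 hx.1)]
    linarith [hx.2]
  induction l with
  | zero =>
    intro f _ hf
    refine ⟨Polynomial.C (f a), by simp, fun x hx => ?_⟩
    have := hf x (hsub hx) a (hsub ha')
    simp only [iteratedDerivWithin_zero] at this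
    rw [Polynomial.eval_C, Nat.cast_zero, add_zero]
    refine this.trans ?_
    gcongr
    exact hdist x hx
  | succ l ih =>
    intro f hcont hf
    have huniq : UniqueDiffOn ℝ (Set.Icc (0 : ℝ) 1) := uniqueDiffOn_Icc one_pos
    have hcont' : ContDiffOn ℝ (l + 1) f (Set.Icc (0 : ℝ) 1) := by exact_mod_cast hcont
    obtain ⟨p, hpdeg, hp⟩ := ih (derivWithin f (Set.Icc 0 1))
      (hcont'.derivWithin huniq le_rfl) (fun x hx y hy => by
        have := hf x hx y hy
        rwa [iteratedDerivWithin_succ'] at this)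
    obtain ⟨P, hPdeg, hP⟩ := exists_derivative_eq p
    refine ⟨P + Polynomial.C (f a - P.eval a), ?_, fun x hx => ?_⟩
    · rw [Polynomial.natDegree_add_C]
      omega
    · have hder : ∀ y ∈ Set.Icc a b, HasDerivWithinAt (fun y => f y - P.eval y)
          (derivWithin f (Set.Icc 0 1) y - p.eval y) (Set.Icc a b) y := by
        intro y hy
        have hdiff := (hcont'.differentiableOn (by simp) y (hsub hy)).hasDerivWithinAt.mono hsub
        have hpoly := (P.hasDerivAt y).hasDerivWithinAt (s := Set.Icc a b)
        rw [hP] at hpoly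
        exact hdiff.sub hpoly
      have hmv := (convex_Icc a b).norm_image_sub_le_of_norm_hasDerivWithin_le hder
        (fun y hy => hp y hy) ha' hx
      rw [Real.norm_eq_abs, Real.norm_eq_abs] at hmv
      have hrw : f x - (P + Polynomial.C (f a - P.eval a)).eval x
          = f x - P.eval x - (f a - P.eval a) := by
        rw [Polynomial.eval_add, Polynomial.eval_C]
        ring
      rw [hrw]
      refine hmv.trans ?_
      calc L * (b - a) ^ (β + l) * |x - a| ≤ L * (b - a) ^ (β + l) * (b - a) := by
            gcongr
            exact hdist x hx
        _ = L * (b - a) ^ (β + (l + 1 : ℕ)) := by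
            rw [mul_assoc, ← Real.rpow_add_one hlen.ne']
            push_cast
            ring_nf

/-- The functions on `[0,1]` bounded by `R` that are approximated on every subinterval by a
polynomial of degree at most `l`, with error at most the length to the power `q`. -/
def PolyApproxBall (q : ℝ) (l : ℕ) (R : ℝ) : Set (ℝ → ℝ) :=
  {f | (∀ a b : ℝ, 0 ≤ a → a < b → b ≤ 1 → ∃ p : Polynomial ℝ, p.natDegree ≤ l ∧
      ∀ x ∈ Set.Icc a b, |f x - p.eval x| ≤ (b - a) ^ q) ∧
    ∀ x ∈ Set.Icc (0 : ℝ) 1, |f x| ≤ R}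

/-- `A` is partitioned into at most `n` pieces of uniform diameter at most `δ` on `[0,1]`. -/
def IsCoded (A : Set (ℝ → ℝ)) (δ : ℝ) (n : ℕ) : Prop :=
  ∃ (ι : Type) (S : Finset ι) (φ : (ℝ → ℝ) → ι), S.card ≤ n ∧ (∀ f ∈ A, φ f ∈ S) ∧
    ∀ f ∈ A, ∀ g ∈ A, φ f = φ g → ∀ x ∈ Set.Icc (0 : ℝ) 1, |f x - g x| ≤ δ

/-- The bound on polynomials of degree at most `l` on `[0,1]` given that their values at `l + 1`
points at distance at least `1 / (2 * (l + 1))` are bounded by one. -/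
noncomputable def nodeConst (l : ℕ) : ℝ := (l + 1) * (2 * (l + 1)) ^ l

lemma nodeConst_pos (l : ℕ) : 0 < nodeConst l := by
  unfold nodeConst
  positivity

lemma abs_eval_le_nodeConst_mul {l : ℕ} {B : ℝ} {v : Fin (l + 1) → ℝ}
    (hv : ∀ i, v i ∈ Set.Icc (0 : ℝ) 1)
    (hsep : ∀ i j, i < j → 1 / (2 * (l + 1)) ≤ v j - v i)
    {p : Polynomial ℝ} (hp : p.natDegree ≤ l) (hB : ∀ i, |p.eval (v i)| ≤ B)
    {x : ℝ} (hx : x ∈ Set.Icc (0 : ℝ) 1) :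
    |p.eval x| ≤ nodeConst l * B := by
  have := abs_eval_le_of_abs_eval_nodes_le (h := 1 / (2 * ((l : ℝ) + 1))) (by positivity) hv
    (fun i j hij => ?_) hp hB hx
  · rwa [one_div_one_div] at this
  · rcases lt_or_gt_of_ne hij with hlt | hlt
    · rw [abs_sub_comm]
      exact (hsep i j hlt).trans (le_abs_self _)
    · exact (hsep j i hlt).trans (le_abs_self _)

/-- Equispaced nodes in `[0,1]`. -/
noncomputable def node (l : ℕ) (i : Fin (l + 1)) : ℝ := i / (l + 1)

lemma node_mem (l : ℕ) (i : Fin (l + 1)) : node l i ∈ Set.Icc (0 : ℝ) 1 := by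
  unfold node
  refine ⟨by positivity, ?_⟩
  rw [div_le_one (by positivity)]
  exact_mod_cast i.is_lt.le

lemma node_sub_node {l : ℕ} {i j : Fin (l + 1)} (hij : i < j) :
    1 / (2 * ((l : ℝ) + 1)) ≤ node l j - node l i := by
  have h : (i : ℝ) + 1 ≤ j := by exact_mod_cast hij
  unfold node
  rw [← sub_div, div_le_div_iff₀ (by positivity) (by positivity)]
  have : (0 : ℝ) < l + 1 := by positivity
  nlinarith

lemma node_injective (l : ℕ) : Function.Injective (node l) := by
  intro i j hij
  have : (0 : ℝ) < 1 / (2 * ((l : ℝ) + 1)) := by positivity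
  rcases lt_trichotomy i j with h | h | h
  · linarith [node_sub_node h]
  · exact h
  · linarith [node_sub_node h]

/-- The polynomial of degree at most `l` with values `z i` at the nodes. -/
noncomputable def nodePoly (l : ℕ) (z : Fin (l + 1) → ℤ) : Polynomial ℝ :=
  Lagrange.interpolate Finset.univ (node l) fun i => (z i : ℝ)

lemma natDegree_nodePoly_le (l : ℕ) (z : Fin (l + 1) → ℤ) : (nodePoly l z).natDegree ≤ l := by
  have h := Lagrange.degree_interpolate_lt (s := Finset.univ) (v := node l)
    (fun i => (z i : ℝ)) (node_injective l).injOn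
  rw [Finset.card_univ, Fintype.card_fin] at h
  rw [Polynomial.natDegree_le_iff_degree_le]
  exact Order.le_of_lt_succ (by exact_mod_cast h)

lemma eval_nodePoly (l : ℕ) (z : Fin (l + 1) → ℤ) (i : Fin (l + 1)) :
    (nodePoly l z).eval (node l i) = z i :=
  Lagrange.eval_interpolate_at_node _ (node_injective l).injOn (Finset.mem_univ i)

/-- Integer parts of the values of a function at the nodes. -/
noncomputable def nodeFloor (l : ℕ) (f : ℝ → ℝ) (i : Fin (l + 1)) : ℤ := ⌊f (node l i)⌋

/-- The radius to which every function approximated by polynomials is reduced by subtracting the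
polynomial interpolating its rounded values. -/
noncomputable def coreRadius (l : ℕ) : ℝ := 1 + nodeConst l * 2

lemma coreRadius_pos (l : ℕ) : 0 < coreRadius l := by
  have := nodeConst_pos l
  unfold coreRadius
  linarith

lemma sub_nodePoly_mem {q : ℝ} {l : ℕ} {R : ℝ} {f : ℝ → ℝ} (hf : f ∈ PolyApproxBall q l R) :
    (fun x => f x - (nodePoly l (nodeFloor l f)).eval x) ∈ PolyApproxBall q l (coreRadius l) := by
  set s := nodePoly l (nodeFloor l f) with hs
  have hsdeg : s.natDegree ≤ l := natDegree_nodePoly_le l _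
  have hsub : ∀ p : Polynomial ℝ, p.natDegree ≤ l → (p - s).natDegree ≤ l := fun p hp =>
    (Polynomial.natDegree_sub_le_of_le hp hsdeg).trans_eq (max_self l)
  refine ⟨fun a b ha hab hb => ?_, fun x hx => ?_⟩
  · obtain ⟨p, hpdeg, hp⟩ := hf.1 a b ha hab hb
    refine ⟨p - s, hsub p hpdeg, fun x hx => ?_⟩
    rw [Polynomial.eval_sub, sub_sub_sub_cancel_right]
    exact hp x hx
  · obtain ⟨p, hpdeg, hp⟩ := hf.1 0 1 le_rfl one_pos le_rfl
    simp only [sub_zero, Real.one_rpow] at hp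
    have hnode : ∀ i, |(p - s).eval (node l i)| ≤ 2 := by
      intro i
      have h1 := abs_le.1 (hp _ (node_mem l i))
      have h2 := Int.floor_le (f (node l i))
      have h3 := Int.lt_floor_add_one (f (node l i))
      rw [Polynomial.eval_sub, hs, eval_nodePoly, nodeFloor, abs_le]
      constructor <;> linarith [h1.1, h1.2]
    have h4 := abs_eval_le_nodeConst_mul (node_mem l) (fun _ _ => node_sub_node)
      (hsub p hpdeg) hnode hx
    rw [Polynomial.eval_sub] at h4
    calc |f x - s.eval x| = |(f x - p.eval x) + (p.eval x - s.eval x)| := by ring_nf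
      _ ≤ |f x - p.eval x| + |p.eval x - s.eval x| := abs_add_le _ _
      _ ≤ coreRadius l := add_le_add (hp x hx) h4

lemma IsCoded.of_core {q : ℝ} {l : ℕ} (R : ℝ) {δ : ℝ} {n : ℕ}
    (h : IsCoded (PolyApproxBall q l (coreRadius l)) δ n) :
    IsCoded (PolyApproxBall q l R) δ ((2 * ⌈R⌉₊ + 2) ^ (l + 1) * n) := by
  obtain ⟨ι, S, φ, hcard, hmem, hφ⟩ := h
  refine ⟨(Fin (l + 1) → ℤ) × ι,
    Fintype.piFinset (fun _ => Finset.Icc (-(⌈R⌉₊ : ℤ) - 1) ⌈R⌉₊) ×ˢ S,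
    fun f => (nodeFloor l f, φ fun x => f x - (nodePoly l (nodeFloor l f)).eval x), ?_, ?_, ?_⟩
  · rw [Finset.card_product, Fintype.card_piFinset_const, Int.card_Icc]
    refine Nat.mul_le_mul (Nat.pow_le_pow_left ?_ _) hcard
    omega
  · intro f hf
    refine Finset.mem_product.2 ⟨Fintype.mem_piFinset.2 fun i => ?_, hmem _ (sub_nodePoly_mem hf)⟩
    have h1 := abs_le.1 (hf.2 _ (node_mem l i))
    have h2 := Nat.le_ceil R
    rw [Finset.mem_Icc]
    change _ ≤ ⌊f (node l i)⌋ ∧ ⌊f (node l i)⌋ ≤ _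
    constructor
    · rw [Int.le_floor]
      push_cast
      linarith [h1.1]
    · have h3 : ((⌊f (node l i)⌋ : ℤ) : ℝ) ≤ ((⌈R⌉₊ : ℤ) : ℝ) := by
        rw [Int.cast_natCast]
        linarith [h1.2, Int.floor_le (f (node l i))]
      exact_mod_cast h3
  · intro f hf g hg hfg x hx
    rw [Prod.mk.injEq] at hfg
    have := hφ _ (sub_nodePoly_mem hf) _ (sub_nodePoly_mem hg) hfg.2 x hx
    rwa [hfg.1, sub_sub_sub_cancel_right] at this

/-- Zooming into a half of `[0,1]` keeps the class, up to the factor `2 ^ q` in the radius. -/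
lemma zoom_mem {q : ℝ} {l : ℕ} {R : ℝ} {f : ℝ → ℝ} (hf : f ∈ PolyApproxBall q l R)
    {c : ℝ} (hc0 : 0 ≤ c) (hc1 : c ≤ 1 / 2) :
    (fun x => 2 ^ q * f (x / 2 + c)) ∈ PolyApproxBall q l (2 ^ q * R) := by
  have h2 : (0 : ℝ) < 2 ^ q := by positivity
  refine ⟨fun a b ha hab hb => ?_, fun x hx => ?_⟩
  · obtain ⟨p, hpdeg, hp⟩ := hf.1 (a / 2 + c) (b / 2 + c) (by linarith) (by linarith) (by linarith)
    refine ⟨Polynomial.C (2 ^ q) *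
      p.comp (Polynomial.C (1 / 2) * Polynomial.X + Polynomial.C c), ?_, fun x hx => ?_⟩
    · refine (Polynomial.natDegree_C_mul_le _ _).trans (Polynomial.natDegree_comp_le.trans ?_)
      calc _ ≤ l * 1 := Nat.mul_le_mul hpdeg Polynomial.natDegree_linear_le
        _ = l := mul_one l
    · have h := hp (x / 2 + c) ⟨by linarith [hx.1], by linarith [hx.2]⟩
      have hev : (Polynomial.C (2 ^ q) *
          p.comp (Polynomial.C (1 / 2) * Polynomial.X + Polynomial.C c)).eval x
          = 2 ^ q * p.eval (x / 2 + c) := by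
        simp only [Polynomial.eval_mul, Polynomial.eval_C, Polynomial.eval_comp,
          Polynomial.eval_add, Polynomial.eval_X]
        ring_nf
      rw [hev, ← mul_sub, abs_mul, abs_of_pos h2]
      calc 2 ^ q * |f (x / 2 + c) - p.eval (x / 2 + c)|
          ≤ 2 ^ q * (b / 2 + c - (a / 2 + c)) ^ q := by gcongr
        _ = (b - a) ^ q := by
            rw [← Real.mul_rpow zero_le_two (by linarith)]
            ring_nf
  · rw [abs_mul, abs_of_pos h2]
    gcongr
    exact hf.2 _ ⟨by linarith [hx.1], by linarith [hx.2]⟩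

lemma IsCoded.halve {q : ℝ} {l : ℕ} {R δ : ℝ} {n : ℕ}
    (h : IsCoded (PolyApproxBall q l (2 ^ q * R)) δ n) :
    IsCoded (PolyApproxBall q l R) (δ / 2 ^ q) (n ^ 2) := by
  have h2 : (0 : ℝ) < 2 ^ q := by positivity
  obtain ⟨ι, S, φ, hcard, hmem, hφ⟩ := h
  have hhalf : (0 : ℝ) ≤ 1 / 2 := by norm_num
  refine ⟨ι × ι, S ×ˢ S, fun f => (φ fun x => 2 ^ q * f (x / 2 + 0),
    φ fun x => 2 ^ q * f (x / 2 + 1 / 2)), ?_, ?_, ?_⟩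
  · rw [Finset.card_product, sq]
    exact Nat.mul_le_mul hcard hcard
  · intro f hf
    exact Finset.mem_product.2
      ⟨hmem _ (zoom_mem hf le_rfl hhalf), hmem _ (zoom_mem hf hhalf le_rfl)⟩
  · intro f hf g hg hfg x hx
    rw [Prod.mk.injEq] at hfg
    rw [le_div_iff₀' h2]
    rcases le_total x (1 / 2) with hx2 | hx2
    · have := hφ _ (zoom_mem hf le_rfl hhalf) _ (zoom_mem hg le_rfl hhalf) hfg.1 (2 * x)
        ⟨by linarith [hx.1], by linarith⟩
      rw [← mul_sub, abs_mul, abs_of_pos h2] at this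
      rwa [show 2 * x / 2 + 0 = x by ring] at this
    · have := hφ _ (zoom_mem hf hhalf le_rfl) _ (zoom_mem hg hhalf le_rfl) hfg.2 (2 * x - 1)
        ⟨by linarith, by linarith [hx.2]⟩
      rw [← mul_sub, abs_mul, abs_of_pos h2] at this
      rwa [show (2 * x - 1) / 2 + 1 / 2 = x by ring] at this

lemma isCoded_core (q : ℝ) (l : ℕ) :
    ∃ K : ℕ, 1 ≤ K ∧ ∀ j : ℕ, IsCoded (PolyApproxBall q l (coreRadius l))
      (2 * coreRadius l / (2 ^ q) ^ j) (K ^ (2 ^ (j + 1))) := by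
  set K := (2 * ⌈2 ^ q * coreRadius l⌉₊ + 2) ^ (l + 1) with hK
  have hK1 : 1 ≤ K := Nat.one_le_pow _ _ (by omega)
  have key : ∀ j : ℕ, IsCoded (PolyApproxBall q l (coreRadius l))
      (2 * coreRadius l / (2 ^ q) ^ j) (K ^ (2 ^ (j + 1) - 2)) := by
    intro j
    induction j with
    | zero =>
      refine ⟨Unit, Finset.univ, fun _ => (), by simp, by simp, fun f hf g hg _ x hx => ?_⟩
      have h1 := abs_le.1 (hf.2 x hx)
      have h2 := abs_le.1 (hg.2 x hx)
      rw [pow_zero, div_one, abs_le]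
      constructor <;> linarith [h1.1, h1.2, h2.1, h2.2]
    | succ j ih =>
      have h := (ih.of_core (2 ^ q * coreRadius l)).halve
      rw [div_div, ← pow_succ, ← hK, ← pow_succ', ← pow_mul] at h
      convert h using 2
      have : 2 ≤ 2 ^ (j + 1) := by
        rw [pow_succ]
        have := Nat.one_le_two_pow (n := j)
        omega
      rw [pow_succ 2 (j + 1)]
      omega
  refine ⟨K, hK1, fun j => ?_⟩
  obtain ⟨ι, S, φ, hcard, hrest⟩ := key j
  exact ⟨ι, S, φ, hcard.trans (Nat.pow_le_pow_right hK1 (Nat.sub_le _ _)), hrest⟩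

lemma HolderClass.integrableOn {L q : ℝ} {f : ℝ → ℝ} (hf : f ∈ HolderClass L q) :
    IntegrableOn f (Set.Icc (0 : ℝ) 1) :=
  hf.2.2.1.continuousOn.integrableOn_Icc

/-- A density is at most `2 / (b - a)` somewhere on `[a, b]`. -/
lemma HolderClass.exists_le {L q : ℝ} {f : ℝ → ℝ} (hf : f ∈ HolderClass L q) {a b : ℝ}
    (ha : 0 ≤ a) (hab : a < b) (hb : b ≤ 1) : ∃ y ∈ Set.Icc a b, f y ≤ 2 / (b - a) := by
  by_contra! hcon
  have hlen : 0 < b - a := sub_pos.2 hab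
  have hsub : Set.Icc a b ⊆ Set.Icc (0 : ℝ) 1 := Set.Icc_subset_Icc ha hb
  have hint := HolderClass.integrableOn hf
  have h1 : ∫ _x in Set.Icc a b, 2 / (b - a) ≤ ∫ x in Set.Icc a b, f x :=
    setIntegral_mono_on (by simp) (hint.mono_set hsub) measurableSet_Icc
      fun x hx => (hcon x hx).le
  have h2 : ∫ x in Set.Icc a b, f x ≤ ∫ x in Set.Icc (0 : ℝ) 1, f x := by
    refine setIntegral_mono_set hint ?_ hsub.eventuallyLE
    filter_upwards [ae_restrict_mem measurableSet_Icc] with x hx using hf.1 x hx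
  rw [hf.2.1] at h2
  rw [setIntegral_const, smul_eq_mul, Real.volume_real_Icc_of_le hab.le,
    mul_div_cancel₀ _ hlen.ne'] at h1
  linarith

lemma HolderClass.div_mem {L q : ℝ} (hq : 0 < q) (hL : 0 < L) :
    ∃ R : ℝ, ∀ f ∈ HolderClass L q,
      (fun x => f x / L) ∈ PolyApproxBall q (holderInt q) R := by
  set l := holderInt q with hl
  have hβ : 0 ≤ q - l := by
    have h1 := Nat.ceil_lt_add_one hq.le
    have h2 : 1 ≤ ⌈q⌉₊ := Nat.one_le_ceil_iff.2 hq
    have h3 : (l : ℝ) + 1 = ⌈q⌉₊ := by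
      rw [hl, holderInt]
      exact_mod_cast Nat.sub_add_cancel h2
    linarith
  have hl0 : (0 : ℝ) < l + 1 := by positivity
  refine ⟨1 + nodeConst l * (4 * (l + 1) / L + 1), fun f hf => ?_⟩
  have happrox : ∀ a b : ℝ, 0 ≤ a → a < b → b ≤ 1 → ∃ p : Polynomial ℝ, p.natDegree ≤ l ∧
      ∀ x ∈ Set.Icc a b, |f x / L - p.eval x| ≤ (b - a) ^ q := by
    intro a b ha hab hb
    obtain ⟨p, hpdeg, hp⟩ :=
      exists_polynomial_approx hL.le hβ ha hab hb l f hf.2.2.1 hf.2.2.2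
    refine ⟨Polynomial.C (1 / L) * p, (Polynomial.natDegree_C_mul_le _ _).trans hpdeg,
      fun x hx => ?_⟩
    have h := hp x hx
    rw [sub_add_cancel] at h
    rw [Polynomial.eval_mul, Polynomial.eval_C,
      show f x / L - 1 / L * p.eval x = (f x - p.eval x) / L by ring, abs_div, abs_of_pos hL,
      div_le_iff₀' hL]
    exact h
  refine ⟨happrox, fun x hx => ?_⟩
  have hexists : ∀ i : Fin (l + 1), ∃ y ∈ Set.Icc (2 * (i : ℝ) / (2 * (l + 1)))
      ((2 * i + 1) / (2 * (l + 1))), f y ≤ 4 * (l + 1) := by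
    intro i
    have hi : (i : ℝ) + 1 ≤ l + 1 := by exact_mod_cast i.is_lt
    have hlt : 2 * (i : ℝ) / (2 * (l + 1)) < (2 * i + 1) / (2 * (l + 1)) := by
      gcongr
      linarith
    obtain ⟨y, hy, hfy⟩ := HolderClass.exists_le hf (by positivity) hlt
      (by rw [div_le_one (by positivity)]; linarith)
    refine ⟨y, hy, hfy.trans_eq ?_⟩
    rw [← sub_div]
    field_simp
    ring
  choose v hv hfv using hexists
  have hv01 : ∀ i, v i ∈ Set.Icc (0 : ℝ) 1 := by
    intro i
    have hi : (i : ℝ) + 1 ≤ l + 1 := by exact_mod_cast i.is_lt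
    refine ⟨le_trans (by positivity) (hv i).1, (hv i).2.trans ?_⟩
    rw [div_le_one (by positivity)]
    linarith
  have hsep : ∀ i j, i < j → 1 / (2 * ((l : ℝ) + 1)) ≤ v j - v i := by
    intro i j hij
    have hij' : (i : ℝ) + 1 ≤ j := by exact_mod_cast hij
    have h1 : (2 * (i : ℝ) + 1) / (2 * (l + 1)) + 1 / (2 * (l + 1)) ≤ 2 * j / (2 * (l + 1)) := by
      rw [← add_div]
      gcongr
      linarith
    linarith [(hv j).1, (hv i).2]
  obtain ⟨p, hpdeg, hp⟩ := happrox 0 1 le_rfl one_pos le_rfl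
  simp only [sub_zero, Real.one_rpow] at hp
  have hpv : ∀ i, |p.eval (v i)| ≤ 4 * (l + 1) / L + 1 := by
    intro i
    have h1 := abs_le.1 (hp _ (hv01 i))
    have h2 : 0 ≤ f (v i) / L := div_nonneg (hf.1 _ (hv01 i)) hL.le
    have h3 : f (v i) / L ≤ 4 * (l + 1) / L := by
      gcongr
      exact hfv i
    rw [abs_le]
    constructor <;> linarith [h1.1, h1.2]
  have h1 := abs_eval_le_nodeConst_mul hv01 hsep hpdeg hpv hx
  calc |f x / L| = |(f x / L - p.eval x) + p.eval x| := by ring_nf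
    _ ≤ |f x / L - p.eval x| + |p.eval x| := abs_add_le _ _
    _ ≤ _ := add_le_add (hp x hx) h1

/-- The Kolmogorov–Tikhomirov entropy bound for the Hölder class in the uniform distance. -/
lemma HolderClass.isCoded {L q : ℝ} (hq : 0 < q) (hL : 0 < L) :
    ∃ C : ℝ, 0 < C ∧ ∀ δ : ℝ, 0 < δ → δ ≤ 1 → ∃ n : ℕ, 1 ≤ n ∧
      IsCoded (HolderClass L q) δ n ∧ Real.log n ≤ C * (1 / δ) ^ (1 / q) := by
  set l := holderInt q
  obtain ⟨R, hR⟩ := HolderClass.div_mem hq hL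
  obtain ⟨K, hK, hcode⟩ := isCoded_core q l
  set M := coreRadius l
  have hM : 0 < M := coreRadius_pos l
  set K' : ℕ := (2 * ⌈R⌉₊ + 2) ^ (l + 1)
  have hK' : 1 ≤ K' := Nat.one_le_pow _ _ (by omega)
  have hlogK : 0 ≤ Real.log K := Real.log_natCast_nonneg K
  have hlogK' : 0 ≤ Real.log K' := Real.log_natCast_nonneg K'
  have hLM : 0 < 2 * L * M := by positivity
  refine ⟨(Real.log K' + 4 * Real.log K + 1) * (1 + 2 * L * M) ^ (1 / q), by positivity,
    fun δ hδ hδ1 => ?_⟩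
  set x := ((1 + 2 * L * M) / δ) ^ (1 / q) with hx
  have hquot : 1 ≤ (1 + 2 * L * M) / δ := by
    rw [one_le_div hδ]
    linarith
  have hx1 : 1 ≤ x := Real.one_le_rpow hquot (by positivity)
  obtain ⟨i, hi1, hi2⟩ := exists_nat_pow_near hx1 one_lt_two
  refine ⟨K' * K ^ (2 ^ (i + 1 + 1)), Nat.one_le_iff_ne_zero.2 (by positivity), ?_, ?_⟩
  · obtain ⟨ι, S, φ, hcard, hmem, hφ⟩ := (hcode (i + 1)).of_core R
    refine ⟨ι, S, fun f => φ fun x => f x / L, hcard, fun f hf => hmem _ (hR f hf),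
      fun f hf g hg hfg y hy => ?_⟩
    have h := hφ _ (hR f hf) _ (hR g hg) hfg y hy
    rw [← sub_div, abs_div, abs_of_pos hL, div_le_iff₀ hL] at h
    refine h.trans ?_
    have hpow : (1 + 2 * L * M) / δ ≤ (2 ^ q) ^ (i + 1) := by
      calc (1 + 2 * L * M) / δ = x ^ q := by
            rw [hx, ← Real.rpow_mul (by positivity), one_div_mul_cancel hq.ne', Real.rpow_one]
        _ ≤ ((2 : ℝ) ^ (i + 1)) ^ q := by gcongr
        _ = (2 ^ q) ^ (i + 1) := by
            rw [← Real.rpow_natCast_mul zero_le_two, mul_comm, Real.rpow_mul_natCast zero_le_two]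
    rw [div_le_iff₀ hδ] at hpow
    rw [div_mul_eq_mul_div, div_le_iff₀ (by positivity)]
    linarith
  · have hxeq : x = (1 + 2 * L * M) ^ (1 / q) * (1 / δ) ^ (1 / q) := by
      rw [hx, ← Real.mul_rpow (by positivity) (by positivity), mul_one_div]
    rw [mul_assoc, ← hxeq]
    push_cast
    rw [Real.log_mul (by positivity) (by positivity), Real.log_pow]
    push_cast
    have h4 : (2 : ℝ) ^ (i + 1 + 1) ≤ 4 * x := by
      rw [pow_succ, pow_succ]
      linarith
    calc Real.log K' + 2 ^ (i + 1 + 1) * Real.log K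
        ≤ Real.log K' * x + 4 * x * Real.log K := by
          gcongr
          exact le_mul_of_one_le_right hlogK' hx1
      _ ≤ (Real.log K' + 4 * Real.log K + 1) * x := by linarith

lemma volume_restrict_unitCube (d : ℕ) :
    (volume : Measure (Fin d → ℝ)).restrict (unitCube d) =
      Measure.pi fun _ => (volume : Measure ℝ).restrict (Set.Icc (0 : ℝ) 1) :=
  Measure.restrict_pi_pi (fun _ => (volume : Measure ℝ)) fun _ => Set.Icc (0 : ℝ) 1

lemma HolderClass.integral_abs {L q : ℝ} {f : ℝ → ℝ} (hf : f ∈ HolderClass L q) :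
    ∫ x in Set.Icc (0 : ℝ) 1, |f x| = 1 :=
  (setIntegral_congr_fun measurableSet_Icc fun x hx => abs_of_nonneg (hf.1 x hx)).trans
    hf.2.1

lemma integrableOn_prod {d : ℕ} {f : Fin d → ℝ → ℝ}
    (hf : ∀ j, IntegrableOn (f j) (Set.Icc (0 : ℝ) 1)) :
    IntegrableOn (fun x : Fin d → ℝ => ∏ j, f j (x j)) (unitCube d) := by
  rw [IntegrableOn, volume_restrict_unitCube]
  exact Integrable.fintype_prod hf

lemma integral_abs_prod {d : ℕ} (f : Fin d → ℝ → ℝ) :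
    ∫ x in unitCube d, |∏ j, f j (x j)| = ∏ j, ∫ x in Set.Icc (0 : ℝ) 1, |f j x| := by
  simp_rw [volume_restrict_unitCube, Finset.abs_prod]
  exact integral_fintype_prod_eq_prod fun j x => |f j x|

lemma prod_sub_prod_eq_sum {d : ℕ} (a b : Fin d → ℝ) :
    ∏ j, a j - ∏ j, b j =
      ∑ i, ∏ j, if j < i then b j else if j = i then a j - b j else a j := by
  have h := Finset.prod_sub_ordered Finset.univ a fun j => a j - b j
  simp only [sub_sub_cancel] at h
  rw [h, sub_sub_cancel]
  refine Finset.sum_congr rfl fun i _ => ?_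
  have hi : a i - b i = ∏ j, if j = i then a j - b j else 1 := by simp
  rw [hi, Finset.prod_filter, Finset.prod_filter, ← Finset.prod_mul_distrib,
    ← Finset.prod_mul_distrib]
  refine Finset.prod_congr rfl fun j _ => ?_
  rcases lt_trichotomy j i with hlt | heq | hgt
  · simp [hlt, hlt.ne, hlt.not_gt]
  · simp [heq]
  · simp [hgt, hgt.ne', hgt.not_gt]

/-- Product densities with uniformly close factors are close in `L¹`. -/
lemma HolderClass.integral_abs_prod_sub_prod_le {L q δ : ℝ} {d : ℕ} {f g : Fin d → ℝ → ℝ}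
    (hf : ∀ j, f j ∈ HolderClass L q) (hg : ∀ j, g j ∈ HolderClass L q)
    (hfg : ∀ j, ∀ x ∈ Set.Icc (0 : ℝ) 1, |f j x - g j x| ≤ δ) :
    ∫ x in unitCube d, |∏ j, f j (x j) - ∏ j, g j (x j)| ≤ d * δ := by
  set h : Fin d → Fin d → ℝ → ℝ := fun i j x =>
    if j < i then g j x else if j = i then f j x - g j x else f j x with hh
  have hint : ∀ i j, IntegrableOn (h i j) (Set.Icc (0 : ℝ) 1) := by
    intro i j
    simp only [hh]
    split_ifs
    · exact HolderClass.integrableOn (hg j)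
    · exact (HolderClass.integrableOn (hf j)).sub (HolderClass.integrableOn (hg j))
    · exact HolderClass.integrableOn (hf j)
  have hdiff : ∀ j, ∫ x in Set.Icc (0 : ℝ) 1, |f j x - g j x| ≤ δ := by
    intro j
    have hle := setIntegral_mono_on
      ((HolderClass.integrableOn (hf j)).sub (HolderClass.integrableOn (hg j))).abs
      (by simp : IntegrableOn (fun _ => δ) (Set.Icc (0 : ℝ) 1)) measurableSet_Icc (hfg j)
    simpa using hle
  have hbound : ∀ i j, ∫ x in Set.Icc (0 : ℝ) 1, |h i j x| ≤ if j = i then δ else 1 := by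
    intro i j
    rcases lt_trichotomy j i with hlt | heq | hgt
    · simp [hh, hlt, hlt.ne, HolderClass.integral_abs (hg j)]
    · simpa [hh, heq] using hdiff i
    · simp [hh, hgt.ne', hgt.not_gt, HolderClass.integral_abs (hf j)]
  calc ∫ x in unitCube d, |∏ j, f j (x j) - ∏ j, g j (x j)|
      ≤ ∫ x in unitCube d, ∑ i, |∏ j, h i j (x j)| := by
        refine integral_mono_of_nonneg (ae_of_all _ fun _ => abs_nonneg _)
          (integrable_finsetSum _ fun i _ => (integrableOn_prod (hint i)).abs)
          (ae_of_all _ fun x => ?_)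
        simp only [prod_sub_prod_eq_sum]
        exact Finset.abs_sum_le_sum_abs _ _
    _ = ∑ i, ∏ j, ∫ x in Set.Icc (0 : ℝ) 1, |h i j x| := by
        rw [integral_finsetSum _ fun i _ => (integrableOn_prod (hint i)).abs]
        exact Finset.sum_congr rfl fun i _ => integral_abs_prod _
    _ ≤ ∑ i, ∏ j, if j = i then δ else 1 :=
        Finset.sum_le_sum fun i _ => Finset.prod_le_prod
          (fun j _ => integral_nonneg fun _ => abs_nonneg _) fun j _ => hbound i j
    _ = d * δ := by simp

/-- The mixture density with weights `p.1` and component densities `p.2`. -/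
def mixture {m d : ℕ} (p : (Fin m → ℝ) × (Fin m → Fin d → ℝ → ℝ)) : (Fin d → ℝ) → ℝ :=
  fun x => ∑ k, p.1 k * ∏ j, p.2 k j (x j)

/-- The admissible parameters of a mixture. -/
def MixtureParam (L q : ℝ) (m d : ℕ) : Set ((Fin m → ℝ) × (Fin m → Fin d → ℝ → ℝ)) :=
  {p | (∀ k, 0 ≤ p.1 k) ∧ ∑ k, p.1 k = 1 ∧ ∀ k j, p.2 k j ∈ HolderClass L q}

lemma integrableOn_mixture {L q : ℝ} {m d : ℕ} {p : (Fin m → ℝ) × (Fin m → Fin d → ℝ → ℝ)}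
    (hp : p ∈ MixtureParam L q m d) : IntegrableOn (mixture p) (unitCube d) :=
  integrable_finsetSum _ fun k _ =>
    (integrableOn_prod fun j => HolderClass.integrableOn (hp.2.2 k j)).const_mul _

lemma tvDist_mixture_le {L q η δ : ℝ} {m d : ℕ}
    {p r : (Fin m → ℝ) × (Fin m → Fin d → ℝ → ℝ)}
    (hp : p ∈ MixtureParam L q m d) (hr : r ∈ MixtureParam L q m d)
    (hw : ∀ k, |p.1 k - r.1 k| ≤ η)
    (hc : ∀ k j, ∀ x ∈ Set.Icc (0 : ℝ) 1, |p.2 k j x - r.2 k j x| ≤ δ) :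
    tvDist (mixture p) (mixture r) ≤ (1 / 2) * (m * η + d * δ) := by
  have hF : ∀ k, IntegrableOn (fun x => ∏ j, p.2 k j (x j)) (unitCube d) := fun k =>
    integrableOn_prod fun j => HolderClass.integrableOn (hp.2.2 k j)
  have hG : ∀ k, IntegrableOn (fun x => ∏ j, r.2 k j (x j)) (unitCube d) := fun k =>
    integrableOn_prod fun j => HolderClass.integrableOn (hr.2.2 k j)
  have hint1 : ∀ k, IntegrableOn (fun x => |p.1 k - r.1 k| * |∏ j, p.2 k j (x j)|)
      (unitCube d) := fun k => (hF k).abs.const_mul _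
  have hint2 : ∀ k, IntegrableOn
      (fun x => r.1 k * |∏ j, p.2 k j (x j) - ∏ j, r.2 k j (x j)|) (unitCube d) :=
    fun k => ((hF k).sub (hG k)).abs.const_mul _
  unfold tvDist
  gcongr
  calc ∫ x in unitCube d, |mixture p x - mixture r x|
      ≤ ∫ x in unitCube d, ∑ k, (|p.1 k - r.1 k| * |∏ j, p.2 k j (x j)| +
          r.1 k * |∏ j, p.2 k j (x j) - ∏ j, r.2 k j (x j)|) := by
        refine integral_mono_of_nonneg (ae_of_all _ fun _ => abs_nonneg _)
          (integrable_finsetSum _ fun k _ => (hint1 k).add (hint2 k)) (ae_of_all _ fun x => ?_)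
        simp only [mixture]
        rw [← Finset.sum_sub_distrib]
        refine (Finset.abs_sum_le_sum_abs _ _).trans (Finset.sum_le_sum fun k _ => ?_)
        calc |p.1 k * ∏ j, p.2 k j (x j) - r.1 k * ∏ j, r.2 k j (x j)|
            = |(p.1 k - r.1 k) * ∏ j, p.2 k j (x j) +
                r.1 k * (∏ j, p.2 k j (x j) - ∏ j, r.2 k j (x j))| := by ring_nf
          _ ≤ _ := (abs_add_le _ _).trans_eq (by
              rw [abs_mul, abs_mul (r.1 k), abs_of_nonneg (hr.1 k)])
    _ = ∑ k, (|p.1 k - r.1 k| +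
          r.1 k * ∫ x in unitCube d, |∏ j, p.2 k j (x j) - ∏ j, r.2 k j (x j)|) := by
        refine (integral_finsetSum _ fun k _ => (hint1 k).add (hint2 k)).trans ?_
        refine Finset.sum_congr rfl fun k _ => ?_
        rw [integral_add' (hint1 k) (hint2 k), integral_const_mul, integral_const_mul,
          integral_abs_prod, Finset.prod_eq_one fun j _ => HolderClass.integral_abs (hp.2.2 k j),
          mul_one]
    _ ≤ ∑ k, (η + r.1 k * (d * δ)) := by
        refine Finset.sum_le_sum fun k _ => add_le_add (hw k) ?_
        exact mul_le_mul_of_nonneg_left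
          (HolderClass.integral_abs_prod_sub_prod_le (hp.2.2 k) (hr.2.2 k) (hc k)) (hr.1 k)
    _ = m * η + d * δ := by
        rw [Finset.sum_add_distrib, ← Finset.sum_mul, hr.2.1]
        simp

lemma tvDist_mixture_zero {L q : ℝ} {m d : ℕ} {p : (Fin m → ℝ) × (Fin m → Fin d → ℝ → ℝ)}
    (hp : p ∈ MixtureParam L q m d) : tvDist (mixture p) 0 ≤ 1 / 2 := by
  have hF : ∀ k, IntegrableOn (fun x => p.1 k * |∏ j, p.2 k j (x j)|) (unitCube d) := fun k =>
    (integrableOn_prod fun j => HolderClass.integrableOn (hp.2.2 k j)).abs.const_mul _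
  unfold tvDist
  refine mul_le_of_le_one_right (by norm_num) ?_
  calc ∫ x in unitCube d, |mixture p x - (0 : (Fin d → ℝ) → ℝ) x|
      ≤ ∫ x in unitCube d, ∑ k, p.1 k * |∏ j, p.2 k j (x j)| := by
        refine integral_mono_of_nonneg (ae_of_all _ fun _ => abs_nonneg _)
          (integrable_finsetSum _ fun k _ => hF k) (ae_of_all _ fun x => ?_)
        simp only [mixture, Pi.zero_apply, sub_zero]
        refine (Finset.abs_sum_le_sum_abs _ _).trans_eq (Finset.sum_congr rfl fun k _ => ?_)
        rw [abs_mul, abs_of_nonneg (hp.1 k)]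
    _ = ∑ k, p.1 k := by
        rw [integral_finsetSum _ fun k _ => hF k]
        refine Finset.sum_congr rfl fun k _ => ?_
        rw [integral_const_mul, integral_abs_prod,
          Finset.prod_eq_one fun j _ => HolderClass.integral_abs (hp.2.2 k j), mul_one]
    _ ≤ 1 := hp.2.1.le

/-- The vectors of `m` natural numbers with sum at most `M`. -/
def boundedSumVectors (m M : ℕ) : Finset (Fin m → ℕ) :=
  {z ∈ Fintype.piFinset fun _ => Finset.range (M + 1) | ∑ k, z k ≤ M}

lemma mem_boundedSumVectors {m M : ℕ} {z : Fin m → ℕ} (hz : ∑ k, z k ≤ M) :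
    z ∈ boundedSumVectors m M := by
  refine Finset.mem_filter.2 ⟨Fintype.mem_piFinset.2 fun k => Finset.mem_range.2 ?_, hz⟩
  have := Finset.single_le_sum (f := z) (fun _ _ => Nat.zero_le _) (Finset.mem_univ k)
  omega

lemma card_boundedSumVectors_le {m M : ℕ} {ε : ℝ} (hε : 0 < ε) (hM : ε * M ≤ m) :
    ((boundedSumVectors m M).card : ℝ) ≤ Real.exp m * ((1 + ε) / ε) ^ m := by
  set c : ℝ := (1 + ε)⁻¹ with hc
  have hc0 : 0 < c := by positivity
  have hc1 : c < 1 := inv_lt_one_of_one_lt₀ (by linarith)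
  have hgeom : ∑ i ∈ Finset.range (M + 1), c ^ i ≤ (1 + ε) / ε := by
    have h1 : (1 - c)⁻¹ = (1 + ε) / ε := by
      have h2 : 1 - c = ε / (1 + ε) := by
        rw [hc, eq_div_iff (by positivity), sub_mul, inv_mul_cancel₀ (by positivity)]
        ring
      rw [h2, inv_div]
    rw [← h1, ← tsum_geometric_of_lt_one hc0.le hc1]
    exact (summable_geometric_of_lt_one hc0.le hc1).sum_le_tsum _ fun _ _ => by positivity
  have hpow : (1 + ε) ^ M ≤ Real.exp m := by
    calc (1 + ε) ^ M ≤ Real.exp ε ^ M := by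
          gcongr
          linarith [Real.add_one_le_exp ε]
      _ = Real.exp (ε * M) := by rw [mul_comm, Real.exp_nat_mul]
      _ ≤ Real.exp m := Real.exp_le_exp.2 hM
  calc ((boundedSumVectors m M).card : ℝ)
      = ∑ _z ∈ boundedSumVectors m M, (1 : ℝ) := by simp
    _ ≤ ∑ z ∈ boundedSumVectors m M, (1 + ε) ^ M * ∏ k, c ^ z k := by
        refine Finset.sum_le_sum fun z hz => ?_
        have hz' : ∑ k, z k ≤ M := (Finset.mem_filter.1 hz).2
        rw [Finset.prod_pow_eq_pow_sum, hc, inv_pow, ← div_eq_mul_inv, one_le_div (by positivity)]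
        exact pow_le_pow_right₀ (by linarith) hz'
    _ ≤ ∑ z ∈ Fintype.piFinset fun _ : Fin m => Finset.range (M + 1),
          (1 + ε) ^ M * ∏ k, c ^ z k :=
        Finset.sum_le_sum_of_subset_of_nonneg (Finset.filter_subset _ _)
          fun _ _ _ => by positivity
    _ = (1 + ε) ^ M * (∑ i ∈ Finset.range (M + 1), c ^ i) ^ m := by
        rw [← Finset.mul_sum, ← Finset.prod_univ_sum]
        simp
    _ ≤ Real.exp m * ((1 + ε) / ε) ^ m := by gcongr

/-- A net consisting of one representative for each value of a code. -/
lemma exists_net_of_code {α β ι : Type*} (P : Set α) (F : α → β) (S : Finset ι) (φ : α → ι)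
    (hφ : ∀ a ∈ P, φ a ∈ S) :
    ∃ N : Set β, N.Finite ∧ Nat.card N ≤ S.card ∧ (∀ g ∈ N, ∃ a ∈ P, F a = g) ∧
      ∀ a ∈ P, ∃ b ∈ P, F b ∈ N ∧ φ a = φ b := by
  rcases P.eq_empty_or_nonempty with rfl | ⟨a₀, ha₀⟩
  · exact ⟨∅, Set.finite_empty, by simp, by simp, by simp⟩
  have hsub : φ '' P ⊆ S := by
    rintro _ ⟨a, ha, rfl⟩
    exact hφ a ha
  have hfin : (φ '' P).Finite := S.finite_toSet.subset hsub
  have hrep : ∀ i, ∃ a, i ∈ φ '' P → a ∈ P ∧ φ a = i := fun i => by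
    by_cases h : i ∈ φ '' P
    · obtain ⟨a, ha⟩ := h
      exact ⟨a, fun _ => ha⟩
    · exact ⟨a₀, fun h' => absurd h' h⟩
  choose rep hrep using hrep
  refine ⟨(fun i => F (rep i)) '' (φ '' P), hfin.image _, ?_, ?_, fun a ha => ?_⟩
  · rw [Nat.card_coe_set_eq]
    refine (Set.ncard_image_le hfin).trans ?_
    rw [← Set.ncard_coe_finset S]
    exact Set.ncard_le_ncard hsub S.finite_toSet
  · rintro _ ⟨i, hi, rfl⟩
    exact ⟨rep i, (hrep i hi).1, rfl⟩
  · have hi := Set.mem_image_of_mem φ ha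
    exact ⟨rep (φ a), (hrep _ hi).1, ⟨φ a, hi, rfl⟩, (hrep _ hi).2.symm⟩

/-- **TV covering entropy of the mixture class (Lemma C.1, upper bound).** There is
`C = C(L,q)` such that for all `m, d ≥ 1` and `ε > 0` the class `G^{(m,d)}_{F_{L,q}}`
admits an `ε`-net of integrable functions of log-cardinality at most
`C m d^{1+1/q} (1/ε)^{1/q}` in total variation. -/
theorem covering_entropy_tv (q L : ℝ) (hq : 0 < q) (hL : 0 < L) :
    ∃ C : ℝ, 0 < C ∧
      ∀ m d : ℕ, 1 ≤ m → 1 ≤ d → ∀ ε : ℝ, 0 < ε →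
        ∃ N : Set ((Fin d → ℝ) → ℝ), N.Finite ∧
          (∀ g ∈ N, IntegrableOn g (unitCube d)) ∧
          Real.log (Nat.card N) ≤
            C * m * (d : ℝ) ^ (1 + 1 / q) * (1 / ε) ^ (1 / q) ∧
          ∀ f ∈ MixtureClass L q m d, ∃ g ∈ N, tvDist f g ≤ ε := by
  obtain ⟨C, hC, hcode⟩ := HolderClass.isCoded hq hL
  refine ⟨C + 2 + q, by positivity, fun m d hm hd ε hε => ?_⟩
  have hm0 : (0 : ℝ) < m := by exact_mod_cast hm
  have hd1 : (1 : ℝ) ≤ d := by exact_mod_cast hd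
  have hd0 : (0 : ℝ) < d := by linarith
  rcases le_or_gt 1 ε with hε1 | hε1
  · refine ⟨{0}, Set.finite_singleton 0, ?_, ?_, ?_⟩
    · rintro g rfl
      exact integrableOn_zero
    · rw [Nat.card_unique, Nat.cast_one, Real.log_one]
      positivity
    · rintro f ⟨π, c, hπ, hsum, hc, rfl⟩
      have h := tvDist_mixture_zero (p := (π, c)) ⟨hπ, hsum, hc⟩
      exact ⟨0, rfl, h.trans (by linarith)⟩
  obtain ⟨n, hn, ⟨ι, S, φ, hcard, hmem, hφ⟩, hlog⟩ :=
    hcode (ε / d) (by positivity) ((div_le_one hd0).2 (hε1.le.trans hd1))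
  set M := ⌊m / ε⌋₊ with hM
  have hMle : (M : ℝ) ≤ m / ε := Nat.floor_le (by positivity)
  have hfloorsum : ∀ p ∈ MixtureParam L q m d, ∑ k, ⌊p.1 k * (m / ε)⌋₊ ≤ M := by
    intro p hp
    rw [hM, Nat.le_floor_iff (by positivity)]
    push_cast
    calc ∑ k, (⌊p.1 k * (m / ε)⌋₊ : ℝ) ≤ ∑ k, p.1 k * (m / ε) :=
          Finset.sum_le_sum fun k _ => Nat.floor_le (mul_nonneg (hp.1 k) (by positivity))
      _ = m / ε := by rw [← Finset.sum_mul, hp.2.1, one_mul]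
  obtain ⟨N, hNfin, hNcard, hNF, hN⟩ := exists_net_of_code (MixtureParam L q m d) mixture
    (boundedSumVectors m M ×ˢ
      Fintype.piFinset fun _ : Fin m => Fintype.piFinset fun _ : Fin d => S)
    (fun p => (fun k => ⌊p.1 k * (m / ε)⌋₊, fun k j => φ (p.2 k j)))
    (fun p hp => Finset.mem_product.2 ⟨mem_boundedSumVectors (hfloorsum p hp),
      Fintype.mem_piFinset.2 fun k => Fintype.mem_piFinset.2 fun j => hmem _ (hp.2.2 k j)⟩)
  refine ⟨N, hNfin, ?_, ?_, ?_⟩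
  · intro g hg
    obtain ⟨p, hp, rfl⟩ := hNF g hg
    exact integrableOn_mixture hp
  · set A : ℝ := (1 / ε) ^ (1 / q) with hA
    have hA1 : 1 ≤ A := Real.one_le_rpow (one_le_one_div hε hε1.le) (by positivity)
    have hlogε : Real.log (1 / ε) ≤ q * A := by
      have h1 := Real.log_le_self (by positivity : 0 ≤ A)
      rw [hA, Real.log_rpow (by positivity), ← hA, div_mul_eq_mul_div, one_mul,
        div_le_iff₀' hq] at h1
      exact h1
    have hlogw : Real.log ((1 + ε) / ε) ≤ (1 + q) * A := by
      rw [← mul_one_div, Real.log_mul (by positivity) (by positivity)]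
      linarith [Real.log_le_sub_one_of_pos (by positivity : 0 < 1 + ε)]
    have hlogn : Real.log n ≤ C * ((d : ℝ) ^ (1 / q) * A) := by
      rw [one_div_div, ← mul_one_div, Real.mul_rpow hd0.le (by positivity)] at hlog
      exact hlog
    have hB : (1 : ℝ) ≤ (d : ℝ) ^ (1 + 1 / q) := Real.one_le_rpow hd1 (by positivity)
    have hBeq : (d : ℝ) * (d : ℝ) ^ (1 / q) = (d : ℝ) ^ (1 + 1 / q) := by
      rw [Real.rpow_add hd0, Real.rpow_one]
    have hn0 : (0 : ℝ) < n := by exact_mod_cast hn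
    have hcardN : (Nat.card N : ℝ) ≤ Real.exp m * ((1 + ε) / ε) ^ m * ((n : ℝ) ^ d) ^ m := by
      have h1 : (Nat.card N : ℝ) ≤ (boundedSumVectors m M).card * ((S.card : ℝ) ^ d) ^ m := by
        refine (Nat.cast_le.2 hNcard).trans_eq ?_
        rw [Finset.card_product, Fintype.card_piFinset_const, Fintype.card_piFinset_const]
        push_cast
        rfl
      refine h1.trans ?_
      gcongr
      refine card_boundedSumVectors_le hε ?_
      rwa [le_div_iff₀' hε] at hMle
    rcases (Nat.card N).eq_zero_or_pos with h0 | hpos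
    · rw [h0, Nat.cast_zero, Real.log_zero]
      positivity
    calc Real.log (Nat.card N)
        ≤ Real.log (Real.exp m * ((1 + ε) / ε) ^ m * ((n : ℝ) ^ d) ^ m) :=
          Real.log_le_log (by exact_mod_cast hpos) hcardN
      _ = m * (1 + Real.log ((1 + ε) / ε) + d * Real.log n) := by
          rw [Real.log_mul (by positivity) (by positivity),
            Real.log_mul (by positivity) (by positivity), Real.log_exp, Real.log_pow,
            Real.log_pow, Real.log_pow]
          ring
      _ ≤ m * (A + (1 + q) * A + d * (C * ((d : ℝ) ^ (1 / q) * A))) := by gcongr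
      _ = m * ((2 + q) * A * 1 + C * (d * (d : ℝ) ^ (1 / q)) * A) := by ring
      _ ≤ m * ((2 + q) * A * (d : ℝ) ^ (1 + 1 / q) + C * (d : ℝ) ^ (1 + 1 / q) * A) := by
          rw [hBeq]
          gcongr
      _ = (C + 2 + q) * m * (d : ℝ) ^ (1 + 1 / q) * A := by ring
  · rintro f ⟨π, c, hπ, hsum, hc, rfl⟩
    have hp : (π, c) ∈ MixtureParam L q m d := ⟨hπ, hsum, hc⟩
    obtain ⟨r, hr, hrN, hcodes⟩ := hN (π, c) hp
    rw [Prod.mk.injEq] at hcodes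
    refine ⟨mixture r, hrN, ?_⟩
    have htv := tvDist_mixture_le (η := ε / m) (δ := ε / d) hp hr (fun k => ?_) fun k j =>
      hφ _ (hp.2.2 k j) _ (hr.2.2 k j) (congrFun (congrFun hcodes.2 k) j)
    · rw [mul_div_cancel₀ _ hm0.ne', mul_div_cancel₀ _ hd0.ne'] at htv
      exact htv.trans_eq (by ring)
    · have hfloor : ⌊π k * (m / ε)⌋₊ = ⌊r.1 k * (m / ε)⌋₊ := congrFun hcodes.1 k
      have h1 := Nat.floor_le (mul_nonneg (hπ k) (by positivity : (0 : ℝ) ≤ m / ε))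
      have h2 := Nat.lt_floor_add_one (π k * (m / ε))
      have h3 := Nat.floor_le (mul_nonneg (hr.1 k) (by positivity : (0 : ℝ) ≤ m / ε))
      have h4 := Nat.lt_floor_add_one (r.1 k * (m / ε))
      rw [hfloor] at h1 h2
      have hscaled : |(π k - r.1 k) * (m / ε)| ≤ 1 := by
        rw [sub_mul, abs_le]
        constructor <;> linarith
      rw [abs_mul, abs_of_pos (by positivity : (0 : ℝ) < m / ε), ← le_div_iff₀ (by positivity),
        one_div_div] at hscaled
      exact hscaled
end

section
/- Fix q > 0 and L > 0. There exist constants c > 0 and ε₀ ∈ (0,1) depending only on L and q such that for all integers m ≥ 2, d ≥ 1 and every ε ∈ (0, ε₀), there exists a finite subset M ⊆ G^{(m,d)}_{F_{L,q}} with log |M| ≥ c · d · (1/ε)^{1/q} whose elements are pairwise at total variation distance at least ε/2, i.e. TV(f,g) ≥ ε/2 for all distinct f, g ∈ M. -/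
open MeasureTheory
open scoped ENNReal

/-- A Gilbert–Varshamov code: exponentially many binary words at pairwise relative Hamming
distance at least `1/4`. -/
lemma exists_code (N : ℕ) : ∃ C : Finset (Fin N → Bool),
    (∀ u ∈ C, ∀ v ∈ C, u ≠ v → (N : ℝ) / 4 ≤ hammingDist u v) ∧
    (Real.log (4 / 3) - Real.log 2 / 4) * N ≤ Real.log C.card := by
  classical
  let S : Finset (Finset (Fin N → Bool)) := Finset.univ.filter fun C =>
    ∀ u ∈ C, ∀ v ∈ C, u ≠ v → (N : ℝ) / 4 ≤ hammingDist u v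
  obtain ⟨C, hC, hmax⟩ := S.exists_max_image Finset.card ⟨∅, by simp [S]⟩
  replace hC : ∀ u ∈ C, ∀ v ∈ C, u ≠ v → (N : ℝ) / 4 ≤ hammingDist u v := by simpa [S] using hC
  refine ⟨C, hC, ?_⟩
  have hcover : ∀ w, ∃ u ∈ C, (hammingDist u w : ℝ) ≤ N / 4 := by
    intro w
    by_contra! h
    have hw : w ∉ C := fun hw => by
      have hlt := h w hw
      rw [hammingDist_self, Nat.cast_zero] at hlt
      exact hlt.not_ge (by positivity)
    have hmem : insert w C ∈ S := by
      simp only [S, Finset.mem_filter, Finset.mem_univ, true_and, Finset.mem_insert]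
      rintro u (rfl | hu) v (rfl | hv) huv
      · exact absurd rfl huv
      · rw [hammingDist_comm]; exact (h v hv).le
      · exact (h u hu).le
      · exact hC u hu v hv huv
    have := hmax _ hmem
    rw [Finset.card_insert_of_notMem hw] at this
    omega
  have hsum : ∀ u : Fin N → Bool, ∑ w, (1 / 2 : ℝ) ^ hammingDist u w = (3 / 2) ^ N := by
    intro u
    have h1 : ∀ w : Fin N → Bool, (1 / 2 : ℝ) ^ hammingDist u w =
        ∏ i, if u i ≠ w i then (1 / 2 : ℝ) else 1 := by
      intro w
      rw [Finset.prod_ite]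
      simp [hammingDist]
    simp_rw [h1]
    have h2 := Finset.prod_univ_sum (fun _ : Fin N => (Finset.univ : Finset Bool))
      (fun i b => if u i ≠ b then (1 / 2 : ℝ) else 1)
    rw [Fintype.piFinset_univ] at h2
    rw [← h2]
    have h3 : ∀ i, ∑ b : Bool, (if u i ≠ b then (1 / 2 : ℝ) else 1) = 3 / 2 := by
      intro i
      cases u i <;> norm_num
    rw [Finset.prod_congr rfl fun i _ => h3 i, Fin.prod_const]
  have hcount : (2 : ℝ) ^ N * (1 / 2 : ℝ) ^ ((N : ℝ) / 4) ≤ C.card * (3 / 2) ^ N := by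
    calc (2 : ℝ) ^ N * (1 / 2 : ℝ) ^ ((N : ℝ) / 4)
        = ∑ _w : Fin N → Bool, (1 / 2 : ℝ) ^ ((N : ℝ) / 4) := by simp
      _ ≤ ∑ w : Fin N → Bool, ∑ u ∈ C, (1 / 2 : ℝ) ^ hammingDist u w := by
          refine Finset.sum_le_sum fun w _ => ?_
          obtain ⟨u, hu, huw⟩ := hcover w
          refine le_trans ?_ (Finset.single_le_sum
            (f := fun u => (1 / 2 : ℝ) ^ hammingDist u w) (fun _ _ => by positivity) hu)
          rw [← Real.rpow_natCast]
          exact Real.rpow_le_rpow_of_exponent_ge (by norm_num) (by norm_num) huw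
      _ = C.card * (3 / 2) ^ N := by
          rw [Finset.sum_comm, Finset.sum_congr rfl fun u _ => hsum u]
          simp
  have hpos : (0 : ℝ) < C.card := by
    by_contra h
    have h0 : (C.card : ℝ) = 0 := le_antisymm (not_lt.1 h) (by positivity)
    rw [h0, zero_mul] at hcount
    have : (0 : ℝ) < 2 ^ N * (1 / 2 : ℝ) ^ ((N : ℝ) / 4) := by positivity
    linarith
  have hlog := Real.log_le_log (by positivity) hcount
  rw [Real.log_mul (by positivity) (by positivity), Real.log_mul (by positivity) (by positivity),
    Real.log_pow, Real.log_pow, Real.log_rpow (by norm_num)] at hlog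
  have e1 : Real.log (1 / 2) = - Real.log 2 := by simp
  have e2 : Real.log (4 / 3) = Real.log 2 - Real.log (3 / 2) := by
    rw [← Real.log_div (by norm_num) (by norm_num)]; norm_num
  rw [e1] at hlog
  rw [e2]
  nlinarith

lemma code_rate_pos : 0 < Real.log (4 / 3) - Real.log 2 / 4 := by
  have h : Real.log 2 < Real.log ((4 / 3) ^ 4) := Real.log_lt_log (by norm_num) (by norm_num)
  rw [Real.log_pow] at h
  push_cast at h
  linarith

/-- A smooth function supported in `(0,1)` with zero mean and positive `L¹` norm. -/
lemma exists_zero_mean_bump : ∃ ψ : ℝ → ℝ, ContDiff ℝ (⊤ : ℕ∞) ψ ∧ HasCompactSupport ψ ∧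
    tsupport ψ ⊆ Set.Ioo 0 1 ∧ ∫ x, ψ x = 0 ∧ 0 < ∫ x, |ψ x| := by
  let b : ContDiffBump (1 / 2 : ℝ) := ⟨1 / 8, 1 / 4, by norm_num, by norm_num⟩
  have hb : ContDiff ℝ (⊤ : ℕ∞) b := b.contDiff
  have hd : ContDiff ℝ (⊤ : ℕ∞) (deriv b) := by
    have : ContDiff ℝ ((⊤ : ℕ∞) + 1) b := by simpa using hb
    exact (contDiff_succ_iff_deriv.1 this).2.2
  have hc : HasCompactSupport (deriv b) := b.hasCompactSupport.deriv
  have hdiff : Differentiable ℝ b := hb.differentiable (by simp)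
  refine ⟨deriv b, hd, hc, ?_, ?_, ?_⟩
  · refine (tsupport_deriv_subset (f := b)).trans ?_
    rw [b.tsupport_eq, Real.closedBall_eq_Icc]
    exact Set.Icc_subset_Ioo (by norm_num [b]) (by norm_num [b])
  · exact integral_eq_zero_of_hasDerivAt_of_integrable (fun x => (hdiff x).hasDerivAt)
      (hd.continuous.integrable_of_hasCompactSupport hc) b.integrable
  · have hne : ∃ x, deriv b x ≠ 0 := by
      by_contra! h
      have h1 : b (1 / 2) = 1 := b.one_of_mem_closedBall (by simp [b])
      have h2 : b 5 = 0 := b.zero_of_le_dist (by norm_num [b, Real.dist_eq, abs_of_pos])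
      have := is_const_of_deriv_eq_zero hdiff h (1 / 2) 5
      linarith
    obtain ⟨x, hx⟩ := hne
    exact hd.continuous.abs.integral_pos_of_hasCompactSupport_nonneg_nonzero
      (hc.comp_left abs_zero) (fun _ => abs_nonneg _) (abs_ne_zero.2 hx)

lemma support_iteratedDeriv_subset_tsupport (f : ℝ → ℝ) (n : ℕ) :
    Function.support (iteratedDeriv n f) ⊆ tsupport f := by
  intro x hx
  refine support_iteratedFDeriv_subset (𝕜 := ℝ) n fun h => hx ?_
  rw [iteratedDeriv_eq_iteratedFDeriv, h]
  rfl

/-- A bounded Lipschitz function is `β`-Hölder for every `β ∈ [0,1]`; here for derivatives of a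
smooth compactly supported function. -/
lemma exists_holder_const_iteratedDeriv {ψ : ℝ → ℝ} (hψ : ContDiff ℝ (⊤ : ℕ∞) ψ)
    (hc : HasCompactSupport ψ) (n : ℕ) {β : ℝ} (h0 : 0 ≤ β) (h1 : β ≤ 1) :
    ∃ C, 0 < C ∧ ∀ x y, |iteratedDeriv n ψ x - iteratedDeriv n ψ y| ≤ C * |x - y| ^ β := by
  have hsmooth : ContDiff ℝ 1 (iteratedDeriv n ψ) := by
    rw [iteratedDeriv_eq_iterate]
    exact ContDiff.iterate_deriv' 1 n (hψ.of_le (by exact_mod_cast le_top))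
  have hcs : HasCompactSupport (iteratedDeriv n ψ) :=
    HasCompactSupport.of_support_subset_isCompact hc (support_iteratedDeriv_subset_tsupport ψ n)
  obtain ⟨K, hK⟩ := ContDiff.lipschitzWith_of_hasCompactSupport hcs hsmooth one_ne_zero
  obtain ⟨B, hB⟩ := hcs.exists_bound_of_continuous hsmooth.continuous
  have hB0 : 0 ≤ B := (norm_nonneg _).trans (hB 0)
  refine ⟨K + 2 * B + 1, by positivity, fun x y => ?_⟩
  rcases le_total |x - y| 1 with h | h
  · have hl := hK.dist_le_mul x y
    rw [Real.dist_eq, Real.dist_eq] at hl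
    have hp : |x - y| ≤ |x - y| ^ β := by
      simpa using Real.rpow_le_rpow_of_exponent_ge' (abs_nonneg (x - y)) h h0 h1
    have : (K : ℝ) * |x - y| ≤ K * |x - y| ^ β := by gcongr
    have : 0 ≤ (2 * B + 1) * |x - y| ^ β := by positivity
    linarith
  · have hp : 1 ≤ |x - y| ^ β := Real.one_le_rpow h h0
    have h2 := (abs_sub (iteratedDeriv n ψ x) (iteratedDeriv n ψ y)).trans
      (add_le_add (hB x) (hB y))
    have : K + 2 * B + 1 ≤ (K + 2 * B + 1) * |x - y| ^ β :=
      le_mul_of_one_le_right (by positivity) hp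
    have : (0 : ℝ) ≤ K := K.2
    linarith

lemma shift_index_unique {θ : ℝ → ℝ} (hθ : Function.support θ ⊆ Set.Ioo 0 1) {y : ℝ} {i j : ℕ}
    (hi : θ (y - i) ≠ 0) (hj : θ (y - j) ≠ 0) : i = j := by
  have h1 := hθ hi
  have h2 := hθ hj
  simp only [Set.mem_Ioo] at h1 h2
  have h3 : (i : ℝ) < j + 1 := by linarith
  have h4 : (j : ℝ) < i + 1 := by linarith
  have h5 : i < j + 1 := by exact_mod_cast h3
  have h6 : j < i + 1 := by exact_mod_cast h4
  omega

lemma sum_indicator_shift_le {θ : ℝ → ℝ} (hθ : Function.support θ ⊆ Set.Ioo 0 1) {N : ℕ} (y : ℝ)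
    {K : ℝ} (hK : 0 ≤ K) : ∑ i : Fin N, (if θ (y - i) ≠ 0 then K else 0) ≤ K := by
  classical
  rw [← Finset.sum_filter, Finset.sum_const, nsmul_eq_mul]
  refine mul_le_of_le_one_left hK ?_
  have : (Finset.univ.filter fun i : Fin N => θ (y - i) ≠ 0).card ≤ 1 := by
    rw [Finset.card_le_one]
    intro i hi j hj
    simp only [Finset.mem_filter, Finset.mem_univ, true_and] at hi hj
    exact Fin.ext (shift_index_unique hθ hi hj)
  exact_mod_cast this

lemma abs_sum_shift {θ : ℝ → ℝ} (hθ : Function.support θ ⊆ Set.Ioo 0 1) {N : ℕ} (c : Fin N → ℝ)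
    (y : ℝ) : |∑ i : Fin N, c i * θ (y - i)| = ∑ i : Fin N, |c i| * |θ (y - i)| := by
  by_cases h : ∃ i : Fin N, θ (y - i) ≠ 0
  · obtain ⟨i, hi⟩ := h
    have h0 : ∀ j : Fin N, j ≠ i → θ (y - j) = 0 := fun j hj => by
      by_contra hne
      exact hj (Fin.ext (shift_index_unique hθ hne hi))
    rw [Finset.sum_eq_single i (fun j _ hj => by simp [h0 j hj]) (by simp),
      Finset.sum_eq_single i (fun j _ hj => by simp [h0 j hj]) (by simp), abs_mul]
  · push Not at h
    simp [h]

lemma abs_sum_shift_le {θ : ℝ → ℝ} (hθ : Function.support θ ⊆ Set.Ioo 0 1) {N : ℕ}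
    {c : Fin N → ℝ} (hc : ∀ i, |c i| ≤ 1) {B : ℝ} (hB : ∀ x, |θ x| ≤ B) (y : ℝ) :
    |∑ i : Fin N, c i * θ (y - i)| ≤ B := by
  rw [abs_sum_shift hθ]
  refine le_trans (Finset.sum_le_sum fun i _ => ?_)
    (sum_indicator_shift_le hθ y ((abs_nonneg _).trans (hB 0)))
  split_ifs with h
  · exact (mul_le_of_le_one_left (abs_nonneg _) (hc i)).trans (hB _)
  · simp [not_not.1 h]

lemma abs_sum_shift_sub_le {θ : ℝ → ℝ} (hθ : Function.support θ ⊆ Set.Ioo 0 1) {N : ℕ}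
    {c : Fin N → ℝ} (hc : ∀ i, |c i| ≤ 1) {C β : ℝ} (hC : 0 ≤ C)
    (hH : ∀ x y, |θ x - θ y| ≤ C * |x - y| ^ β) (y z : ℝ) :
    |∑ i : Fin N, c i * θ (y - i) - ∑ i : Fin N, c i * θ (z - i)| ≤ 2 * (C * |y - z| ^ β) := by
  have hK : 0 ≤ C * |y - z| ^ β := by positivity
  rw [← Finset.sum_sub_distrib, two_mul]
  refine (Finset.abs_sum_le_sum_abs _ _).trans ?_
  have hsum := add_le_add
    (sum_indicator_shift_le (N := N) hθ y hK) (sum_indicator_shift_le (N := N) hθ z hK)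
  rw [← Finset.sum_add_distrib] at hsum
  refine le_trans (Finset.sum_le_sum fun i _ => ?_) hsum
  rw [← mul_sub, abs_mul]
  have h1 : |c i| * |θ (y - i) - θ (z - i)| ≤ C * |y - z| ^ β := by
    refine (mul_le_of_le_one_left (abs_nonneg _) (hc i)).trans ?_
    simpa using hH (y - i) (z - i)
  split_ifs with h2 h3 h3
  · linarith
  · linarith
  · linarith
  · simp [not_not.1 h2, not_not.1 h3]

lemma setIntegral_comp_scale_shift {g : ℝ → ℝ} (hg : Function.support g ⊆ Set.Ioo 0 1) {N : ℕ}
    (i : Fin N) : ∫ x in Set.Icc (0 : ℝ) 1, g (N * x - i) = (N : ℝ)⁻¹ * ∫ x, g x := by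
  have hN : (0 : ℝ) < N := by exact_mod_cast i.pos
  rw [setIntegral_eq_integral_of_forall_compl_eq_zero]
  · rw [Measure.integral_comp_mul_left (fun y => g (y - i)) (N : ℝ),
      integral_sub_right_eq_self g (i : ℝ), smul_eq_mul, abs_of_pos (by positivity)]
  · intro x hx
    by_contra hne
    have h := hg hne
    simp only [Set.mem_Ioo] at h
    have hi : (i : ℝ) + 1 ≤ N := by exact_mod_cast i.2
    have hi0 : (0 : ℝ) ≤ i := by positivity
    refine hx ⟨?_, ?_⟩
    · by_contra hx0
      nlinarith
    · by_contra hx1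
      nlinarith

/-- The uniform density perturbed by rescaled copies of `ψ` on the cells selected by `w`. -/
noncomputable def perturbedDensity (ψ : ℝ → ℝ) (a : ℝ) {N : ℕ} (w : Fin N → Bool) (x : ℝ) : ℝ :=
  1 + a * ∑ i : Fin N, (if w i then 1 else 0) * ψ (N * x - i)

lemma contDiff_perturbedDensity {ψ : ℝ → ℝ} (hψ : ContDiff ℝ (⊤ : ℕ∞) ψ) (a : ℝ) {N : ℕ}
    (w : Fin N → Bool) : ContDiff ℝ (⊤ : ℕ∞) (perturbedDensity ψ a w) := by
  unfold perturbedDensity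
  fun_prop

lemma iteratedDeriv_perturbedDensity {ψ : ℝ → ℝ} (hψ : ContDiff ℝ (⊤ : ℕ∞) ψ) (a : ℝ) {N : ℕ}
    (w : Fin N → Bool) (n : ℕ) (x : ℝ) :
    iteratedDeriv n (perturbedDensity ψ a w) x = (if n = 0 then 1 else 0) +
      a * N ^ n * ∑ i : Fin N, (if w i then 1 else 0) * iteratedDeriv n ψ (N * x - i) := by
  have hn : ContDiff ℝ n ψ := hψ.of_le (by exact_mod_cast le_top)
  have hterm : ∀ i : Fin N, iteratedDeriv n (fun z => ψ (N * z - i)) x =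
      N ^ n * iteratedDeriv n ψ (N * x - i) := fun i => by
    have hs : ContDiff ℝ n fun y => ψ (y - i) := by fun_prop
    rw [iteratedDeriv_comp_const_mul hs, iteratedDeriv_comp_sub_const]
  unfold perturbedDensity
  rw [iteratedDeriv_fun_add (by fun_prop) (by fun_prop), iteratedDeriv_const,
    iteratedDeriv_const_mul_field, iteratedDeriv_fun_sum (fun i _ => by fun_prop)]
  simp_rw [iteratedDeriv_const_mul_field, hterm, mul_assoc, Finset.mul_sum]
  congr 1
  refine Finset.sum_congr rfl fun i _ => by ring

lemma holderInt_le {q : ℝ} (hq : 0 < q) : (holderInt q : ℝ) ≤ q := by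
  have h1 : 1 ≤ ⌈q⌉₊ := Nat.one_le_ceil_iff.2 hq
  have h2 := Nat.ceil_lt_add_one hq.le
  rw [holderInt, Nat.cast_sub h1]
  push_cast
  linarith

lemma le_holderInt_add_one {q : ℝ} (hq : 0 < q) : q ≤ holderInt q + 1 := by
  have h1 : 1 ≤ ⌈q⌉₊ := Nat.one_le_ceil_iff.2 hq
  have h2 := Nat.le_ceil q
  rw [holderInt, Nat.cast_sub h1]
  push_cast
  linarith

lemma perturbedDensity_mem_holderClass {ψ : ℝ → ℝ} (hψ : ContDiff ℝ (⊤ : ℕ∞) ψ)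
    (hsupp : tsupport ψ ⊆ Set.Ioo 0 1) (hmean : ∫ x, ψ x = 0) {q L A B C : ℝ}
    (hA : 0 ≤ A) (hB : ∀ x, |ψ x| ≤ B) (hAB : A * B ≤ 1) (hC : 0 ≤ C)
    (hH : ∀ x y, |iteratedDeriv (holderInt q) ψ x - iteratedDeriv (holderInt q) ψ y| ≤
      C * |x - y| ^ (q - holderInt q)) (hAC : 2 * A * C ≤ L) (hq : 0 < q) {N : ℕ} (hN : 0 < N)
    (w : Fin N → Bool) : perturbedDensity ψ (A * (N : ℝ) ^ (-q)) w ∈ HolderClass L q := by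
  have hs : Function.support ψ ⊆ Set.Ioo 0 1 := (subset_tsupport ψ).trans hsupp
  have hN' : (0 : ℝ) < N := by exact_mod_cast hN
  have hN1 : (1 : ℝ) ≤ N := by exact_mod_cast hN
  have hB0 : 0 ≤ B := (abs_nonneg _).trans (hB 0)
  have hw : ∀ i, |(if w i then (1 : ℝ) else 0)| ≤ 1 := fun i => by split_ifs <;> simp
  have hcd := contDiff_perturbedDensity hψ (A * (N : ℝ) ^ (-q)) w
  have hcdn : ContDiff ℝ (holderInt q) (perturbedDensity ψ (A * (N : ℝ) ^ (-q)) w) :=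
    hcd.of_le (by exact_mod_cast le_top)
  refine ⟨fun x _ => ?_, ?_, hcdn.contDiffOn, fun x hx y hy => ?_⟩
  · have h1 := abs_sum_shift_le hs hw hB (N * x)
    have h2 : (N : ℝ) ^ (-q) ≤ 1 := Real.rpow_le_one_of_one_le_of_nonpos hN1 (by linarith)
    have h3 : |A * (N : ℝ) ^ (-q) *
        ∑ i : Fin N, (if w i then (1 : ℝ) else 0) * ψ (N * x - i)| ≤ 1 := by
      rw [abs_mul, abs_of_nonneg (by positivity)]
      calc A * (N : ℝ) ^ (-q) * _ ≤ A * 1 * B := by gcongr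
        _ ≤ 1 := by linarith
    have := (abs_le.1 h3).1
    unfold perturbedDensity
    linarith
  · have hint : ∀ i : Fin N, IntegrableOn
        (fun x => (if w i then (1 : ℝ) else 0) * ψ (N * x - i)) (Set.Icc 0 1) := fun i =>
      Continuous.integrableOn_Icc (by have := hψ.continuous; fun_prop)
    unfold perturbedDensity
    rw [integral_add (by simp) ((integrable_finsetSum _ fun i _ => hint i).const_mul _),
      integral_const_mul, integral_finsetSum _ fun i _ => hint i]
    simp_rw [integral_const_mul, setIntegral_comp_scale_shift hs, hmean]
    simp
  · have hu : UniqueDiffOn ℝ (Set.Icc (0 : ℝ) 1) := uniqueDiffOn_Icc zero_lt_one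
    rw [iteratedDerivWithin_eq_iteratedDeriv hu hcdn.contDiffAt hx,
      iteratedDerivWithin_eq_iteratedDeriv hu hcdn.contDiffAt hy,
      iteratedDeriv_perturbedDensity hψ, iteratedDeriv_perturbedDensity hψ,
      add_sub_add_left_eq_sub, ← mul_sub, abs_mul, abs_of_nonneg (by positivity)]
    have hsl := (support_iteratedDeriv_subset_tsupport ψ (holderInt q)).trans hsupp
    have h := abs_sum_shift_sub_le hsl hw hC hH (N * x) (N * y)
    rw [← mul_sub, abs_mul, abs_of_pos hN', Real.mul_rpow hN'.le (abs_nonneg _)] at h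
    have hpow : (N : ℝ) ^ (-q) * N ^ holderInt q * (N : ℝ) ^ (q - holderInt q) = 1 := by
      rw [← Real.rpow_natCast, ← Real.rpow_add hN', ← Real.rpow_add hN']
      simp
    calc A * (N : ℝ) ^ (-q) * N ^ holderInt q * _
        ≤ A * (N : ℝ) ^ (-q) * N ^ holderInt q *
          (2 * (C * ((N : ℝ) ^ (q - holderInt q) * |x - y| ^ (q - holderInt q)))) := by
          gcongr
      _ = (2 * A * C) * |x - y| ^ (q - holderInt q) *
          ((N : ℝ) ^ (-q) * N ^ holderInt q * (N : ℝ) ^ (q - holderInt q)) := by ring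
      _ ≤ L * |x - y| ^ (q - holderInt q) := by
          rw [hpow, mul_one]
          gcongr

lemma integral_abs_perturbedDensity_sub {ψ : ℝ → ℝ} (hψ : Continuous ψ)
    (hs : Function.support ψ ⊆ Set.Ioo 0 1) {a : ℝ} (ha : 0 ≤ a) {N : ℕ} (u v : Fin N → Bool) :
    ∫ x in Set.Icc (0 : ℝ) 1, |perturbedDensity ψ a u x - perturbedDensity ψ a v x| =
      a * (hammingDist u v * ((N : ℝ)⁻¹ * ∫ x, |ψ x|)) := by
  have hs' : Function.support (fun x => |ψ x|) ⊆ Set.Ioo 0 1 := fun x hx =>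
    hs (abs_ne_zero.1 hx)
  have hpt : ∀ x, |perturbedDensity ψ a u x - perturbedDensity ψ a v x| =
      a * ∑ i : Fin N, (if u i ≠ v i then 1 else 0) * |ψ (N * x - i)| := by
    intro x
    unfold perturbedDensity
    rw [add_sub_add_left_eq_sub, ← mul_sub, ← Finset.sum_sub_distrib, abs_mul, abs_of_nonneg ha]
    simp_rw [← sub_mul]
    rw [abs_sum_shift hs]
    congr 1
    refine Finset.sum_congr rfl fun i _ => ?_
    cases u i <;> cases v i <;> simp
  simp_rw [hpt]
  rw [integral_const_mul, integral_finsetSum _ fun i _ =>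
    Continuous.integrableOn_Icc (by fun_prop)]
  simp_rw [integral_const_mul, setIntegral_comp_scale_shift hs']
  rw [← Finset.sum_mul, Finset.sum_boole, hammingDist]

/-- The `L¹` distance of product densities dominates that of each pair of factors. -/
lemma integral_abs_sub_le_integral_abs_prod_sub {d : ℕ} {f g : Fin d → ℝ → ℝ}
    (hf : ∀ j, Continuous (f j)) (hg : ∀ j, Continuous (g j))
    (hf1 : ∀ j, ∫ x in Set.Icc (0 : ℝ) 1, f j x = 1)
    (hg1 : ∀ j, ∫ x in Set.Icc (0 : ℝ) 1, g j x = 1) (j : Fin d) :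
    ∫ x in Set.Icc (0 : ℝ) 1, |f j x - g j x| ≤
      ∫ x in unitCube d, |∏ i, f i (x i) - ∏ i, g i (x i)| := by
  classical
  let s : ℝ → ℝ := fun x => if g j x ≤ f j x then 1 else -1
  have hsm : Measurable s := Measurable.ite
    (measurableSet_le (hg j).measurable (hf j).measurable) measurable_const measurable_const
  have hs1 : ∀ x, |s x| = 1 := fun x => by simp only [s]; split_ifs <;> simp
  have hsabs : ∀ x, s x * f j x - s x * g j x = |f j x - g j x| := fun x => by
    simp only [s]
    split_ifs with h
    · rw [abs_of_nonneg (by linarith)]; ring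
    · rw [abs_of_neg (by linarith)]; ring
  have hvol : (volume : Measure (Fin d → ℝ)).restrict (unitCube d) =
      Measure.pi fun _ => (volume : Measure ℝ).restrict (Set.Icc 0 1) := by
    rw [unitCube, volume_pi, Measure.restrict_pi_pi]
  have hint : ∀ h : Fin d → ℝ → ℝ, (∀ i, Continuous (h i)) → ∀ i,
      Integrable (h i) ((volume : Measure ℝ).restrict (Set.Icc 0 1)) := fun h hh i =>
    (hh i).integrableOn_Icc
  have hsint : ∀ h : ℝ → ℝ, Continuous h →
      Integrable (fun x => s x * h x) ((volume : Measure ℝ).restrict (Set.Icc 0 1)) :=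
    fun h hh => (hh.integrableOn_Icc).bdd_mul hsm.aestronglyMeasurable
      (ae_of_all _ fun x => (hs1 x).le)
  have hupd : ∀ h : Fin d → ℝ → ℝ, ∀ x : Fin d → ℝ,
      ∏ i, (Function.update h j fun t => s t * h j t) i (x i) = s (x j) * ∏ i, h i (x i) := by
    intro h x
    rw [← Finset.mul_prod_erase _ _ (Finset.mem_univ j),
      ← Finset.mul_prod_erase Finset.univ (fun i => h i (x i)) (Finset.mem_univ j),
      Function.update_self, mul_assoc]
    congr 2
    refine Finset.prod_congr rfl fun i hi => ?_
    rw [Function.update_of_ne (Finset.ne_of_mem_erase hi)]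
  have hprodint : ∀ h : Fin d → ℝ → ℝ, (∀ i, Continuous (h i)) →
      Integrable (fun x => s (x j) * ∏ i, h i (x i))
        (Measure.pi fun _ : Fin d => (volume : Measure ℝ).restrict (Set.Icc 0 1)) := by
    intro h hh
    simp_rw [← hupd]
    refine Integrable.fintype_prod fun i => ?_
    rcases eq_or_ne i j with rfl | hij
    · rw [Function.update_self]; exact hsint _ (hh i)
    · rw [Function.update_of_ne hij]; exact hint h hh i
  have hval : ∀ h : Fin d → ℝ → ℝ, (∀ i, ∫ x in Set.Icc (0 : ℝ) 1, h i x = 1) →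
      ∫ x, s (x j) * ∏ i, h i (x i)
        ∂(Measure.pi fun _ : Fin d => (volume : Measure ℝ).restrict (Set.Icc 0 1)) =
      ∫ x in Set.Icc (0 : ℝ) 1, s x * h j x := by
    intro h hh
    simp_rw [← hupd]
    rw [integral_fintype_prod_eq_prod, Finset.prod_eq_single j]
    · rw [Function.update_self]
    · intro i _ hij
      rw [Function.update_of_ne hij, hh]
    · simp
  rw [hvol]
  simp_rw [← hsabs]
  rw [integral_sub (hsint _ (hf j)) (hsint _ (hg j)), ← hval f hf1, ← hval g hg1,
    ← integral_sub (hprodint f hf) (hprodint g hg)]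
  refine integral_mono ((hprodint f hf).sub (hprodint g hg)) ?_ fun x => ?_
  · exact ((Integrable.fintype_prod (hint f hf)).sub (Integrable.fintype_prod (hint g hg))).abs
  · simp only
    rw [← mul_sub]
    refine (le_abs_self _).trans ?_
    rw [abs_mul, hs1, one_mul]

/-- Product densities belong to every mixture class with at least one component. -/
lemma prod_mem_mixtureClass {L q : ℝ} {m d : ℕ} (hm : 0 < m) {f : Fin d → ℝ → ℝ}
    (hf : ∀ j, f j ∈ HolderClass L q) : (fun x => ∏ j, f j (x j)) ∈ MixtureClass L q m d := by
  have hm' : (m : ℝ) ≠ 0 := by exact_mod_cast hm.ne'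
  refine ⟨fun _ => (m : ℝ)⁻¹, fun _ => f, fun _ => by positivity, by simp [hm'],
    fun _ j => hf j, ?_⟩
  funext x
  rw [Finset.sum_const, Finset.card_univ, Fintype.card_fin, nsmul_eq_mul, ← mul_assoc,
    mul_inv_cancel₀ hm', one_mul]

/-- **TV packing entropy of the mixture class (Lemma C.1, lower bound).** There are
`c = c(L,q) > 0` and `ε₀ = ε₀(L,q) ∈ (0,1)` such that for all `m ≥ 2`, `d ≥ 1` and
`ε ∈ (0,ε₀)` the class `G^{(m,d)}_{F_{L,q}}` contains an `(ε/2)`-separated (in total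
variation) finite subset of log-cardinality at least `c d (1/ε)^{1/q}`. -/
theorem packing_entropy_tv (q L : ℝ) (hq : 0 < q) (hL : 0 < L) :
    ∃ c ε₀ : ℝ, 0 < c ∧ 0 < ε₀ ∧ ε₀ < 1 ∧
      ∀ m d : ℕ, 2 ≤ m → 1 ≤ d → ∀ ε : ℝ, 0 < ε → ε < ε₀ →
        ∃ M : Set ((Fin d → ℝ) → ℝ), M ⊆ MixtureClass L q m d ∧ M.Finite ∧
          c * d * (1 / ε) ^ (1 / q) ≤ Real.log (Nat.card M) ∧
          M.Pairwise fun f g => ε / 2 ≤ tvDist f g := by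
  obtain ⟨ψ, hψ, hcs, hsupp, hmean, hκ⟩ := exists_zero_mean_bump
  obtain ⟨B, hB⟩ := hcs.exists_bound_of_continuous hψ.continuous
  obtain ⟨C, hC, hH⟩ := exists_holder_const_iteratedDeriv hψ hcs (holderInt q)
    (β := q - holderInt q) (by linarith [holderInt_le hq]) (by linarith [le_holderInt_add_one hq])
  have hB0 : 0 ≤ B := (norm_nonneg _).trans (hB 0)
  have hs : Function.support ψ ⊆ Set.Ioo 0 1 := (subset_tsupport ψ).trans hsupp
  set κ := ∫ x, |ψ x|
  set r := Real.log (4 / 3) - Real.log 2 / 4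
  have hr : 0 < r := code_rate_pos
  let A := min (1 / (B + 1)) (L / (2 * C))
  have hA : 0 < A := lt_min (by positivity) (by positivity)
  have hAB : A * B ≤ 1 := by
    have h1 : A * (B + 1) ≤ 1 := (le_div_iff₀ (by positivity)).1 (min_le_left _ _)
    nlinarith
  have hAC : 2 * A * C ≤ L := by
    have h1 : A * (2 * C) ≤ L := (le_div_iff₀ (by positivity)).1 (min_le_right _ _)
    linarith
  let R := A * κ / 4
  have hR : 0 < R := by positivity
  refine ⟨r / 2 * R ^ (1 / q), min R (1 / 2), by positivity, lt_min hR (by norm_num),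
    (min_le_right _ _).trans_lt (by norm_num), fun m d hm _ ε hε hε₀ => ?_⟩
  let X := (R / ε) ^ (1 / q)
  have hX : 1 ≤ X := Real.one_le_rpow
    ((one_le_div hε).2 (hε₀.le.trans (min_le_left _ _))) (by positivity)
  let N := ⌊X⌋₊
  have hN : 0 < N := Nat.floor_pos.2 hX
  have hN' : (0 : ℝ) < N := by exact_mod_cast hN
  have hNX : (N : ℝ) ≤ X := Nat.floor_le (by linarith)
  have hXN : X / 2 ≤ N := by
    have h1 : X < N + 1 := Nat.lt_floor_add_one X
    have h2 : (1 : ℝ) ≤ N := by exact_mod_cast hN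
    linarith
  have hNq : ε ≤ R * (N : ℝ) ^ (-q) := by
    have h1 : (N : ℝ) ^ q ≤ R / ε := by
      calc (N : ℝ) ^ q ≤ X ^ q := by gcongr
        _ = R / ε := by
          rw [← Real.rpow_mul (by positivity), one_div_mul_cancel hq.ne', Real.rpow_one]
    rw [Real.rpow_neg hN'.le, ← div_eq_mul_inv, le_div_iff₀ (by positivity)]
    rw [le_div_iff₀ hε] at h1
    linarith
  obtain ⟨K, hsep, hcard⟩ := exists_code N
  let p : (Fin N → Bool) → ℝ → ℝ := perturbedDensity ψ (A * (N : ℝ) ^ (-q))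
  have hp : ∀ w, p w ∈ HolderClass L q := fun w =>
    perturbedDensity_mem_holderClass hψ hsupp hmean hA.le hB hAB hC.le hH hAC hq hN w
  have hpc : ∀ w, Continuous (p w) := fun w => (contDiff_perturbedDensity hψ _ w).continuous
  let Φ : (Fin d → K) → (Fin d → ℝ) → ℝ := fun w x => ∏ j, p (w j) (x j)
  have hΦ : ∀ u v, u ≠ v → ε / 2 ≤ tvDist (Φ u) (Φ v) := by
    intro u v huv
    obtain ⟨j, hj⟩ := Function.ne_iff.1 huv
    have h1 := integral_abs_sub_le_integral_abs_prod_sub (fun i => hpc (u i)) (fun i => hpc (v i))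
      (fun i => (hp (u i)).2.1) (fun i => (hp (v i)).2.1) j
    rw [integral_abs_perturbedDensity_sub hψ.continuous hs (by positivity)] at h1
    have h2 := hsep _ (u j).2 _ (v j).2 (fun h => hj (Subtype.ext h))
    have h3 : ε ≤ A * (N : ℝ) ^ (-q) *
        (hammingDist (u j).1 (v j).1 * ((N : ℝ)⁻¹ * κ)) := by
      calc ε ≤ R * (N : ℝ) ^ (-q) := hNq
        _ = A * (N : ℝ) ^ (-q) * ((N / 4) * ((N : ℝ)⁻¹ * κ)) := by
            simp only [R]; field_simp
        _ ≤ _ := by gcongr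
    rw [tvDist]
    linarith [h3.trans h1]
  have hinj : Function.Injective Φ := by
    intro u v huv
    by_contra hne
    have h1 := hΦ u v hne
    rw [huv] at h1
    simp only [tvDist, sub_self, abs_zero, integral_zero, mul_zero] at h1
    linarith
  refine ⟨Set.range Φ, ?_, Set.finite_range Φ, ?_, ?_⟩
  · rintro _ ⟨w, rfl⟩
    exact prod_mem_mixtureClass (by omega) fun j => hp (w j)
  · have hcardΦ : Nat.card (Set.range Φ) = K.card ^ d := by
      rw [Nat.card_range_of_injective hinj]
      simp
    rw [hcardΦ, Nat.cast_pow, Real.log_pow]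
    have hXe : X = R ^ (1 / q) * (1 / ε) ^ (1 / q) := by
      rw [← Real.mul_rpow hR.le (by positivity), mul_one_div]
    calc r / 2 * R ^ (1 / q) * d * (1 / ε) ^ (1 / q) = d * (r * (X / 2)) := by rw [hXe]; ring
      _ ≤ d * (r * N) := by gcongr
      _ ≤ d * Real.log K.card := by gcongr
  · rintro _ ⟨u, rfl⟩ _ ⟨v, rfl⟩ huv
    exact hΦ u v fun h => huv (h ▸ rfl)
end
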